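/- arXiv:math/9707212 — 3 statements merged into one kernel-verified Lean document; each statement's English description precedes it below -/
import Mathlib

section
/- Let A' = (a'₁,…,a'_{m'}) and A'' = (a''₁,…,a''_{m''}) with m', m'' ≥ 1 and all entries ≥ 2, and let Q', Q'' and Q be the quotient complexes of collections of 2-connected graphs associated to A', to A'', and to the concatenated multiindex A = (a'₁,…,a'_{m'},a''₁,…,a''_{m''}) respectively, where the vertex set of Q is the disjoint union of the vertex sets of Q' and Q'' ordered with the vertices of Q' first. Set p = 2|A'| − 3m' − 1 and q = 2|A''| − 3m'' − 1. Then the bilinear join map sending a pair of faces (S', S'') to the face S' ∪ S'' carries cycles of degrees p and q of Q' and Q'' to cycles of degree p + q + 1 of Q and carries boundaries to boundaries, and the induced homomorphism H_p(Q') ⊗ H_q(Q'') → H_{p+q+1}(Q) is an isomorphism of abelian groups. -/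
set_option autoImplicit false

/-!
Statement 5: the join of chains induces an isomorphism
H_p(Q') ⊗ H_q(Q'') → H_{p+q+1}(Q) for the quotient complexes of collections of
2-connected graphs associated to multiindices A', A'' and their concatenation,
where p = 2|A'| − 3m' − 1 and q = 2|A''| − 3m'' − 1.
-/

noncomputable section

open Finset

/-- Generators of degree `d` of the simplicial chain complex on the vertex set `V`:
`(d+1)`-element subsets of `V`. -/
abbrev Gen (V : Type) (d : ℕ) : Type := {S : Finset V // S.card = d + 1}

/-- The degree-`d` chain group: the free abelian group on the `(d+1)`-element
subsets of `V`. -/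
abbrev Chain (V : Type) (d : ℕ) : Type := Gen V d →₀ ℤ

/-- The simplicial boundary operator: `∂S = Σ_m (−1)^{m−1} (S − s_m)`, where
`s₁ < s₂ < …` are the elements of `S` (the sign of the summand removing `s`
is `(−1)` to the number of elements of `S` smaller than `s`).  In degree `0`
it is the zero map. -/
def bdry (V : Type) [LinearOrder V] (d : ℕ) :
    Chain V d →ₗ[ℤ] Chain V (d - 1) := by
  classical
  exact Finsupp.lift (Chain V (d - 1)) ℤ (Gen V d) fun S =>
    ∑ s ∈ S.1, ((-1 : ℤ) ^ (S.1.filter fun t => t < s).card) •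
      (if h : (S.1.erase s).card = (d - 1) + 1
        then Finsupp.single (⟨S.1.erase s, h⟩ : Gen V (d - 1)) (1 : ℤ) else 0)

/-- The subgroup of degree-`d` chains spanned by the "bad" faces, i.e. those not
satisfying the predicate `good`.  The quotient complex is the quotient of the
chain complex of the simplex by these subgroups. -/
def badChains (V : Type) (good : Finset V → Prop) (d : ℕ) : Submodule ℤ (Chain V d) :=
  Submodule.span ℤ {x | ∃ S : Gen V d, ¬ good S.1 ∧ x = Finsupp.single S 1}

/-- Cycles of degree `d` of the quotient complex: chains whose boundary vanishes
in the quotient, i.e. lies in the span of the bad faces. -/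
def cycles (V : Type) [LinearOrder V] (good : Finset V → Prop) (d : ℕ) :
    Submodule ℤ (Chain V d) :=
  Submodule.comap (bdry V d) (badChains V good (d - 1))

/-- The degree-`d` homology of the quotient complex: cycles modulo
(bad chains + boundaries). -/
abbrev homology (V : Type) [LinearOrder V] (good : Finset V → Prop) (d : ℕ) : Type :=
  (cycles V good d) ⧸ (Submodule.comap (cycles V good d).subtype
    (badChains V good d ⊔ LinearMap.range (bdry V (d + 1))))

/-- Edges of the complete graph on `Fin k`: unordered pairs of distinct nodes,
encoded as ordered pairs `(a, b)` with `a < b`. -/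
abbrev Edge (k : ℕ) : Type := {p : Fin k × Fin k // p.1 < p.2}

/-- The lexicographic order on edges induced by the order of the nodes. -/
instance (k : ℕ) : LinearOrder (Edge k) :=
  LinearOrder.lift' (fun e => toLex e.1) fun a b h => Subtype.ext (toLex.injective h)

/-- The graph on the `k` nodes `Fin k` with the given edge set. -/
def graphOf (k : ℕ) (S : Finset (Edge k)) : SimpleGraph (Fin k) :=
  SimpleGraph.fromEdgeSet {q | ∃ p ∈ S, q = s(p.1.1, p.1.2)}


/-- The homology class of a chain which is a cycle of the quotient complex
(and `0` otherwise). -/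
def cls (V : Type) [LinearOrder V] (good : Finset V → Prop) (d : ℕ)
    (x : Chain V d) : homology V good d := by
  classical
  exact if h : x ∈ cycles V good d then Submodule.Quotient.mk ⟨x, h⟩ else 0

/-- The vertex set of the simplex associated to the multiindex `A`: the
disjoint union `E₁ ⊔ … ⊔ E_m`, where `E_j` is the set of all unordered pairs
of distinct nodes of the `j`-th node set `N_j = Fin (A j)`. -/
abbrev VtxE (m : ℕ) (A : Fin m → ℕ) : Type := Σ j : Fin m, Edge (A j)

/-- The graph on `N_j = Fin (A j)` with edge set `S ∩ E_j`. -/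
def grOf (m : ℕ) (A : Fin m → ℕ) (S : Finset (VtxE m A)) (j : Fin m) :
    SimpleGraph (Fin (A j)) :=
  SimpleGraph.fromEdgeSet
    {q : Sym2 (Fin (A j)) |
      ∃ e : Edge (A j), (⟨j, e⟩ : VtxE m A) ∈ S ∧ q = s(e.1.1, e.1.2)}

/-- A face `S` is good iff for every `j` the graph on `N_j` with edge set
`S ∩ E_j` is 2-connected. -/
def goodTwoConn (m : ℕ) (A : Fin m → ℕ) (S : Finset (VtxE m A)) : Prop :=
  ∀ j : Fin m, (grOf m A S j).Connected ∧
    ∀ v : Fin (A j), ((grOf m A S j).induce {u | u ≠ v}).Connected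

/-- The linear order on a disjoint union `α ⊕ β` of two linearly ordered sets
placing all elements of `α` first. -/
instance sumLinearOrder (α β : Type) [LinearOrder α] [LinearOrder β] :
    LinearOrder (α ⊕ β) :=
  LinearOrder.lift' (fun x => (toLex x : α ⊕ₗ β)) toLex.injective

/-- `p = 2|A| − 3m − 1`: the degree in which the homology of the quotient
complex of collections of 2-connected graphs is concentrated. -/
def topDeg (m : ℕ) (A : Fin m → ℕ) : ℕ := 2 * (∑ j, A j) - 3 * m - 1

section Join

variable (m' m'' : ℕ) (A' : Fin m' → ℕ) (A'' : Fin m'' → ℕ)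

/-- The good faces for the concatenated multiindex `A = A' ∪ A''`, on the
vertex set `V' ⊕ V''`: all the graphs of the collection (those of `A'` and
those of `A''`) are 2-connected. -/
def goodCat (S : Finset (VtxE m' A' ⊕ VtxE m'' A'')) : Prop :=
  goodTwoConn m' A' (S.preimage Sum.inl Sum.inl_injective.injOn) ∧
  goodTwoConn m'' A'' (S.preimage Sum.inr Sum.inr_injective.injOn)

variable (p q : ℕ)

/-- The join of two faces, as a generator: the union `S' ∪ S''` inside
`V' ⊕ V''`. -/
def joinGen (S' : Gen (VtxE m' A') p) (S'' : Gen (VtxE m'' A'') q) :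
    Gen (VtxE m' A' ⊕ VtxE m'' A'') (p + q + 1) := by
  classical
  refine ⟨S'.1.map ⟨Sum.inl, Sum.inl_injective⟩ ∪ S''.1.map ⟨Sum.inr, Sum.inr_injective⟩, ?_⟩
  have hdisj : Disjoint (S'.1.map ⟨Sum.inl, Sum.inl_injective⟩)
      (S''.1.map ⟨Sum.inr, Sum.inr_injective⟩) := by
    rw [Finset.disjoint_left]
    rintro x hx hx'
    rw [Finset.mem_map] at hx hx'
    obtain ⟨u, -, rfl⟩ := hx
    obtain ⟨v, -, h⟩ := hx'
    simp at h
  rw [Finset.card_union_of_disjoint hdisj, Finset.card_map, Finset.card_map, S'.2, S''.2]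
  omega

/-- The bilinear join map, sending a pair of faces `(S', S'')` to the face
`S' ∪ S''`. -/
def join : Chain (VtxE m' A') p →ₗ[ℤ]
    Chain (VtxE m'' A'') q →ₗ[ℤ] Chain (VtxE m' A' ⊕ VtxE m'' A'') (p + q + 1) :=
  Finsupp.lift _ ℤ _ fun S' => Finsupp.lift _ ℤ _ fun S'' =>
    Finsupp.single (joinGen m' m'' A' A'' p q S' S'') 1

end Join

open scoped TensorProduct

namespace FaceComplex

/-- Chains of all degrees at once, on all finite subsets of `V`, the empty one included. -/
abbrev FaceChain (V : Type) : Type := Finset V →₀ ℤ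

/-- Two linear maps out of `FaceChain V` agree if they agree on faces. -/
theorem total_ext {V M : Type} [AddCommGroup M] {f g : FaceChain V →ₗ[ℤ] M}
    (h : ∀ S : Finset V, f (Finsupp.single S 1) = g (Finsupp.single S 1)) : f = g := by
  apply Finsupp.lhom_ext'
  intro S
  ext
  simpa using h S

section Projection

variable {V : Type}

open Classical in
/-- The projection onto the span of the faces satisfying `p`. -/
def proj (p : Finset V → Prop) : FaceChain V →ₗ[ℤ] FaceChain V :=
  Finsupp.linearCombination ℤ fun S => if p S then Finsupp.single S 1 else 0

open Classical in
theorem proj_single (p : Finset V → Prop) (S : Finset V) :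
    proj p (Finsupp.single S 1) = if p S then Finsupp.single S 1 else 0 := by
  simp [proj]

theorem proj_single_of_pos {p : Finset V → Prop} {S : Finset V} (h : p S) :
    proj p (Finsupp.single S 1) = Finsupp.single S 1 := by
  simp [proj_single, h]

theorem proj_single_of_neg {p : Finset V → Prop} {S : Finset V} (h : ¬ p S) :
    proj p (Finsupp.single S 1) = 0 := by
  simp [proj_single, h]

theorem proj_proj (p : Finset V → Prop) (x : FaceChain V) : proj p (proj p x) = proj p x := by
  suffices h : proj p ∘ₗ proj p = proj p from LinearMap.congr_fun h x
  refine total_ext fun S => ?_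
  by_cases hS : p S <;> simp [proj_single, hS]

theorem proj_comm (p q : Finset V → Prop) (x : FaceChain V) :
    proj p (proj q x) = proj q (proj p x) := by
  suffices h : proj p ∘ₗ proj q = proj q ∘ₗ proj p from LinearMap.congr_fun h x
  refine total_ext fun S => ?_
  by_cases hS : p S <;> by_cases hS' : q S <;> simp [proj_single, hS, hS']

open Classical in
theorem proj_apply (p : Finset V → Prop) (x : FaceChain V) (S : Finset V) :
    proj p x S = if p S then x S else 0 := by
  induction x using Finsupp.induction_linear with
  | zero => simp
  | add f g hf hg => rw [map_add, Finsupp.add_apply, hf, hg, Finsupp.add_apply]; split_ifs <;> simp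
  | single T a =>
    have : (Finsupp.single T a : FaceChain V) = a • Finsupp.single T 1 := by simp
    rw [this, map_smul, proj_single]
    by_cases hT : T = S
    · subst hT; split_ifs <;> simp
    · split_ifs <;> simp [hT]

/-- The component in which faces have `c` elements. -/
def level (c : ℕ) : FaceChain V →ₗ[ℤ] FaceChain V := proj fun S => S.card = c

/-- The sign `(-1) ^ |S|`. -/
def parity : FaceChain V →ₗ[ℤ] FaceChain V :=
  Finsupp.linearCombination ℤ fun S => (-1 : ℤ) ^ S.card • Finsupp.single S 1

theorem parity_single (S : Finset V) :
    parity (Finsupp.single S 1) = (-1 : ℤ) ^ S.card • Finsupp.single S (1 : ℤ) := by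
  simp [parity]

theorem parity_parity (x : FaceChain V) : parity (parity x) = x := by
  suffices h : parity ∘ₗ parity = LinearMap.id from LinearMap.congr_fun h x
  refine total_ext fun S => ?_
  simp only [LinearMap.comp_apply, parity_single, map_smul, smul_smul, LinearMap.id_apply]
  rw [← mul_pow]
  simp

theorem proj_parity (p : Finset V → Prop) (x : FaceChain V) :
    proj p (parity x) = parity (proj p x) := by
  suffices h : proj p ∘ₗ parity = parity ∘ₗ proj p from LinearMap.congr_fun h x
  refine total_ext fun S => ?_
  by_cases hS : p S <;> simp only [LinearMap.comp_apply, parity_single, map_smul, proj_single, hS,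
    if_true, if_false, map_zero, smul_zero]

theorem mem_span_single_iff {p : Finset V → Prop} {x : FaceChain V} :
    proj p x = x ↔ x ∈ Submodule.span ℤ {y | ∃ S, p S ∧ y = Finsupp.single S 1} := by
  constructor
  · intro h
    rw [← h]
    clear h
    induction x using Finsupp.induction_linear with
    | zero => simp
    | add f g hf hg => rw [map_add]; exact add_mem hf hg
    | single T a =>
      have : (Finsupp.single T a : FaceChain V) = a • Finsupp.single T 1 := by simp
      rw [this, map_smul]
      apply Submodule.smul_mem
      by_cases hT : p T
      · rw [proj_single_of_pos hT]
        exact Submodule.subset_span ⟨T, hT, rfl⟩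
      · rw [proj_single_of_neg hT]
        exact zero_mem _
  · intro h
    induction h using Submodule.span_induction with
    | mem y hy => obtain ⟨S, hS, rfl⟩ := hy; exact proj_single_of_pos hS
    | zero => simp
    | add y z _ _ hy hz => rw [map_add, hy, hz]
    | smul a y _ hy => rw [map_smul, hy]

/-- A map raising cardinalities by one commutes accordingly with the levels. -/
theorem level_succ_comm {f : FaceChain V →ₗ[ℤ] FaceChain V}
    (hf : ∀ S : Finset V, level (S.card + 1) (f (Finsupp.single S 1)) = f (Finsupp.single S 1))
    (c : ℕ) (x : FaceChain V) : level (c + 1) (f x) = f (level c x) := by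
  suffices h : level (c + 1) ∘ₗ f = f ∘ₗ level c from LinearMap.congr_fun h x
  refine total_ext fun S => ?_
  simp only [LinearMap.comp_apply]
  by_cases hS : S.card = c
  · rw [level, level, proj_single_of_pos (p := fun S => S.card = c) hS]
    subst hS
    exact hf S
  · rw [level, level, proj_single_of_neg (p := fun S => S.card = c) hS, map_zero, ← hf S]
    ext T
    rw [proj_apply, level, proj_apply]
    split_ifs <;> first | rfl | omega

/-- A map shifting levels by one anticommutes with the parity. -/
theorem parity_anticomm {f : FaceChain V →ₗ[ℤ] FaceChain V}
    (hf : ∀ (c : ℕ) (x : FaceChain V), level (c + 1) (f x) = f (level c x)) (x : FaceChain V) :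
    parity (f x) = - f (parity x) := by
  have key : ∀ (c : ℕ) (y : FaceChain V), level c y = y → parity y = (-1 : ℤ) ^ c • y := by
    intro c y hy
    rw [level, mem_span_single_iff] at hy
    induction hy using Submodule.span_induction with
    | mem y hy => obtain ⟨S, hS, rfl⟩ := hy; rw [parity_single, hS]
    | zero => simp
    | add y z _ _ hy hz => rw [map_add, hy, hz, smul_add]
    | smul a y _ hy => rw [map_smul, hy, smul_comm]
  suffices h : parity ∘ₗ f = - (f ∘ₗ parity) from LinearMap.congr_fun h x
  refine total_ext fun S => ?_
  have hS : level S.card (Finsupp.single S 1) = Finsupp.single S (1 : ℤ) :=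
    proj_single_of_pos (p := fun T => T.card = S.card) rfl
  rw [LinearMap.comp_apply, key (S.card + 1) _ (by rw [hf, hS])]
  rw [LinearMap.neg_apply, LinearMap.comp_apply, parity_single, map_smul, pow_succ, mul_neg_one,
    neg_smul]

end Projection

section Boundary

variable {V : Type} [LinearOrder V]

/-- The sign attached to the position of `s` relative to the elements of `S`. -/
def sgn (s : V) (S : Finset V) : ℤ := (-1) ^ (S.filter fun t => t < s).card

theorem sgn_mul_self (s : V) (S : Finset V) : sgn s S * sgn s S = 1 := by
  rw [sgn, ← mul_pow]; simp

theorem sgn_erase_self (s : V) (S : Finset V) : sgn s (S.erase s) = sgn s S := by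
  rw [sgn, sgn]
  congr 2
  ext t
  simp only [mem_filter, mem_erase]
  exact ⟨fun h => ⟨h.1.2, h.2⟩, fun h => ⟨⟨h.2.ne, h.1⟩, h.2⟩⟩

theorem sgn_insert_of_lt {e s : V} {S : Finset V} (he : e ∉ S) (h : e < s) :
    sgn s (insert e S) = - sgn s S := by
  rw [sgn, sgn, filter_insert, if_pos h, card_insert_of_notMem (by simp [he]), pow_succ]
  ring

theorem sgn_insert_of_not_lt {e s : V} {S : Finset V} (h : ¬ e < s) :
    sgn s (insert e S) = sgn s S := by
  rw [sgn, sgn, filter_insert, if_neg h]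

theorem sgn_insert_mul_add {e s : V} {S : Finset V} (he : e ∉ S) (hs : s ∈ S) :
    sgn e S * sgn s (insert e S) + sgn s S * sgn e (S.erase s) = 0 := by
  have hes : e ≠ s := fun h => he (h ▸ hs)
  have hS : insert s (S.erase s) = S := insert_erase hs
  rcases lt_or_gt_of_ne hes with h | h
  · have h1 : sgn e S = sgn e (S.erase s) := by
      conv_lhs => rw [← hS]
      exact sgn_insert_of_not_lt h.not_gt
    rw [sgn_insert_of_lt he h, h1]
    ring
  · have h1 : sgn e S = - sgn e (S.erase s) := by
      conv_lhs => rw [← hS]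
      exact sgn_insert_of_lt (notMem_erase s S) h
    rw [sgn_insert_of_not_lt h.not_gt, h1]
    ring

/-- The boundary operator of the augmented chain complex of the full simplex. -/
def bd : FaceChain V →ₗ[ℤ] FaceChain V :=
  Finsupp.linearCombination ℤ fun S => ∑ s ∈ S, sgn s S • Finsupp.single (S.erase s) 1

theorem bd_single (S : Finset V) :
    bd (Finsupp.single S 1) = ∑ s ∈ S, sgn s S • Finsupp.single (S.erase s) (1 : ℤ) := by
  simp [bd]

/-- Exterior multiplication by the vertex `e`. -/
def wedge (e : V) : FaceChain V →ₗ[ℤ] FaceChain V :=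
  Finsupp.linearCombination ℤ fun S =>
    if e ∈ S then 0 else sgn e S • Finsupp.single (insert e S) 1

theorem wedge_single_of_mem {e : V} {S : Finset V} (h : e ∈ S) :
    wedge e (Finsupp.single S 1) = 0 := by
  simp [wedge, h]

theorem wedge_single_of_notMem {e : V} {S : Finset V} (h : e ∉ S) :
    wedge e (Finsupp.single S 1) = sgn e S • Finsupp.single (insert e S) (1 : ℤ) := by
  simp [wedge, h]

theorem bd_wedge_add (e : V) (x : FaceChain V) : bd (wedge e x) + wedge e (bd x) = x := by
  suffices h : bd ∘ₗ wedge e + wedge e ∘ₗ bd = LinearMap.id from LinearMap.congr_fun h x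
  refine total_ext fun S => ?_
  simp only [LinearMap.add_apply, LinearMap.comp_apply, LinearMap.id_apply]
  by_cases he : e ∈ S
  · rw [wedge_single_of_mem he, map_zero, zero_add, bd_single, map_sum, Finset.sum_eq_single e]
    · rw [map_smul, wedge_single_of_notMem (notMem_erase e S), smul_smul, sgn_erase_self,
        sgn_mul_self, one_smul, insert_erase he]
    · intro s _ hse
      rw [map_smul, wedge_single_of_mem (mem_erase.2 ⟨hse.symm, he⟩), smul_zero]
    · exact fun h => absurd he h
  · rw [wedge_single_of_notMem he, map_smul, bd_single, bd_single, sum_insert he, erase_insert he,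
      sgn_insert_of_not_lt (lt_irrefl e), smul_add, smul_smul, sgn_mul_self, one_smul, map_sum,
      smul_sum, add_assoc, ← sum_add_distrib, sum_eq_zero, add_zero]
    intro s hs
    have hes : e ≠ s := fun h => he (h ▸ hs)
    rw [map_smul, wedge_single_of_notMem (fun h => he (mem_of_mem_erase h)), smul_smul, smul_smul,
      erase_insert_of_ne hes, ← add_smul, sgn_insert_mul_add he hs, zero_smul]

theorem bd_bd (x : FaceChain V) : bd (bd x) = 0 := by
  suffices h : (bd ∘ₗ bd : FaceChain V →ₗ[ℤ] FaceChain V) = 0 from LinearMap.congr_fun h x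
  refine total_ext fun S => ?_
  simp only [LinearMap.comp_apply, LinearMap.zero_apply]
  induction S using Finset.induction_on with
  | empty => simp [bd_single]
  | insert e S he ih =>
    have hw : (Finsupp.single (insert e S) 1 : FaceChain V)
        = sgn e S • wedge e (Finsupp.single S 1) := by
      rw [wedge_single_of_notMem he, smul_smul, sgn_mul_self, one_smul]
    have h1 := bd_wedge_add e (Finsupp.single S 1)
    have h2 := bd_wedge_add e (bd (Finsupp.single S 1))
    rw [ih, map_zero, add_zero] at h2
    rw [hw, map_smul, map_smul, eq_sub_of_add_eq h1, map_sub, h2, sub_self, smul_zero]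

theorem level_bd (c : ℕ) (x : FaceChain V) : level c (bd x) = bd (level (c + 1) x) := by
  suffices h : level c ∘ₗ bd = (bd ∘ₗ level (c + 1) : FaceChain V →ₗ[ℤ] FaceChain V) from
    LinearMap.congr_fun h x
  refine total_ext fun S => ?_
  simp only [LinearMap.comp_apply, level, proj_single, bd_single, map_sum, map_smul]
  split_ifs with h
  · rw [bd_single]
    refine sum_congr rfl fun s hs => ?_
    rw [if_pos (by rw [card_erase_of_mem hs, h]; rfl)]
  · rw [map_zero]
    refine sum_eq_zero fun s hs => ?_
    rw [if_neg, smul_zero]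
    have := card_erase_add_one hs
    omega

theorem bd_parity (x : FaceChain V) : bd (parity x) = - parity (bd x) := by
  suffices h : bd ∘ₗ parity = - (parity ∘ₗ bd : FaceChain V →ₗ[ℤ] FaceChain V) from
    LinearMap.congr_fun h x
  refine total_ext fun S => ?_
  simp only [LinearMap.comp_apply, LinearMap.neg_apply, parity_single, map_smul, bd_single,
    map_sum, smul_sum, ← sum_neg_distrib]
  refine sum_congr rfl fun s hs => ?_
  rw [← card_erase_add_one hs, pow_succ, smul_comm, mul_smul]
  simp

end Boundary

section Quotient

variable {V : Type} [LinearOrder V] (good : Finset V → Prop)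

/-- The boundary operator of the quotient by the faces which are not good. -/
def qbd : FaceChain V →ₗ[ℤ] FaceChain V := proj good ∘ₗ bd

theorem qbd_apply (x : FaceChain V) : qbd good x = proj good (bd x) := rfl

theorem proj_qbd (x : FaceChain V) : proj good (qbd good x) = qbd good x := proj_proj _ _

variable {good}

theorem qbd_proj (hup : ∀ S T, S ⊆ T → good S → good T) (x : FaceChain V) :
    qbd good (proj good x) = qbd good x := by
  suffices h : qbd good ∘ₗ proj good = qbd good from LinearMap.congr_fun h x
  refine total_ext fun S => ?_
  rw [LinearMap.comp_apply]
  by_cases hS : good S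
  · rw [proj_single_of_pos hS]
  · rw [proj_single_of_neg hS, map_zero, qbd_apply, bd_single, map_sum, sum_eq_zero]
    intro s _
    rw [map_smul, proj_single_of_neg fun h => hS (hup _ _ (erase_subset s S) h), smul_zero]

theorem qbd_qbd (hup : ∀ S T, S ⊆ T → good S → good T) (x : FaceChain V) :
    qbd good (qbd good x) = 0 := by
  rw [qbd_apply good x, qbd_proj hup, qbd_apply, bd_bd, map_zero]

theorem level_qbd (c : ℕ) (x : FaceChain V) :
    level c (qbd good x) = qbd good (level (c + 1) x) := by
  rw [qbd_apply, qbd_apply, ← level_bd, level, proj_comm]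

theorem qbd_parity (x : FaceChain V) : qbd good (parity x) = - parity (qbd good x) := by
  rw [qbd_apply, qbd_apply, bd_parity, map_neg, proj_parity]

end Quotient

section Contraction

variable {V : Type} [LinearOrder V]

/-- The quotient complex by the faces which are not good admits a contracting homotopy on the
faces with fewer than `k` vertices. -/
def ContractibleBelow (good : Finset V → Prop) (k : ℕ) : Prop :=
  ∃ h : FaceChain V →ₗ[ℤ] FaceChain V, (∀ x, h (proj good x) = h x) ∧ (∀ x, proj good (h x) = h x) ∧
    (∀ c x, level (c + 1) (h x) = h (level c x)) ∧
    ∀ S, good S → S.card < k →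
      qbd good (h (Finsupp.single S 1)) + h (qbd good (Finsupp.single S 1)) = Finsupp.single S 1

section Toggle

variable (good : Finset V → Prop) (k : ℕ) (r : Finset V → ℕ) (e : Finset V → V)

open Classical in
/-- Exterior multiplication of each good face `S` with fewer than `k` vertices by `e S`. -/
def toggle : FaceChain V →ₗ[ℤ] FaceChain V :=
  Finsupp.linearCombination ℤ fun S =>
    if good S ∧ S.card < k then wedge (e S) (Finsupp.single S 1) else 0

/-- The defect of `toggle` from being a contracting homotopy. -/
def defect : FaceChain V →ₗ[ℤ] FaceChain V :=
  proj good - qbd good ∘ₗ toggle good k e - toggle good k e ∘ₗ qbd good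

variable {good k r e}

theorem toggle_single_of_pos {S : Finset V} (hS : good S) (hk : S.card < k) :
    toggle good k e (Finsupp.single S 1) = wedge (e S) (Finsupp.single S 1) := by
  simp [toggle, hS, hk]

theorem toggle_single_of_neg {S : Finset V} (hS : ¬ (good S ∧ S.card < k)) :
    toggle good k e (Finsupp.single S 1) = 0 := by
  simp only [toggle, Finsupp.linearCombination_single, if_neg hS, smul_zero]

theorem toggle_proj (x : FaceChain V) : toggle good k e (proj good x) = toggle good k e x := by
  suffices h : toggle good k e ∘ₗ proj good = toggle good k e from LinearMap.congr_fun h x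
  refine total_ext fun S => ?_
  rw [LinearMap.comp_apply]
  by_cases hS : good S
  · rw [proj_single_of_pos hS]
  · rw [proj_single_of_neg hS, map_zero, toggle_single_of_neg fun h => hS h.1]

theorem proj_toggle (hup : ∀ S T, S ⊆ T → good S → good T) (x : FaceChain V) :
    proj good (toggle good k e x) = toggle good k e x := by
  suffices h : proj good ∘ₗ toggle good k e = toggle good k e from LinearMap.congr_fun h x
  refine total_ext fun S => ?_
  rw [LinearMap.comp_apply]
  by_cases hS : good S ∧ S.card < k
  · rw [toggle_single_of_pos hS.1 hS.2]
    by_cases he : e S ∈ S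
    · rw [wedge_single_of_mem he, map_zero]
    · rw [wedge_single_of_notMem he, map_smul,
        proj_single_of_pos (hup _ _ (subset_insert _ _) hS.1)]
  · rw [toggle_single_of_neg hS, map_zero]

theorem level_toggle (c : ℕ) (x : FaceChain V) :
    level (c + 1) (toggle good k e x) = toggle good k e (level c x) := by
  refine level_succ_comm (fun S => ?_) c x
  by_cases hS : good S ∧ S.card < k
  · rw [toggle_single_of_pos hS.1 hS.2]
    by_cases he : e S ∈ S
    · rw [wedge_single_of_mem he, map_zero]
    · rw [wedge_single_of_notMem he, map_smul, level,
        proj_single_of_pos (p := fun T => T.card = S.card + 1) (card_insert_of_notMem he)]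
  · rw [toggle_single_of_neg hS, map_zero]

theorem proj_defect (hup : ∀ S T, S ⊆ T → good S → good T) (x : FaceChain V) :
    proj good (defect good k e x) = defect good k e x := by
  simp only [defect, LinearMap.sub_apply, LinearMap.comp_apply, map_sub, proj_proj, proj_qbd,
    proj_toggle hup]

theorem level_defect (c : ℕ) (x : FaceChain V) :
    level c (defect good k e x) = defect good k e (level c x) := by
  have h1 : level c (toggle good k e (qbd good x)) = toggle good k e (qbd good (level c x)) := by
    cases c with
    | zero =>
      have h0 : (qbd good (level 0 x) : FaceChain V) = 0 := by
        suffices h : qbd good ∘ₗ level 0 = 0 from LinearMap.congr_fun h x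
        refine total_ext fun S => ?_
        by_cases hS : S.card = 0
        · rw [card_eq_zero] at hS
          simp [level, proj_single, hS, qbd_apply, bd_single]
        · simp [level, proj_single, card_eq_zero.not.1 hS]
      rw [h0, map_zero]
      suffices h : level 0 ∘ₗ toggle good k e = 0 from LinearMap.congr_fun h _
      refine total_ext fun S => ?_
      by_cases hS : good S ∧ S.card < k
      · rw [LinearMap.comp_apply, toggle_single_of_pos hS.1 hS.2]
        by_cases he : e S ∈ S
        · rw [wedge_single_of_mem he, map_zero, LinearMap.zero_apply]
        · rw [wedge_single_of_notMem he, map_smul, level, proj_single_of_neg (by simp), smul_zero,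
            LinearMap.zero_apply]
      · rw [LinearMap.comp_apply, toggle_single_of_neg hS, map_zero, LinearMap.zero_apply]
    | succ c => rw [level_toggle, level_qbd]
  rw [defect, LinearMap.sub_apply, LinearMap.sub_apply, LinearMap.sub_apply, LinearMap.sub_apply,
    map_sub, map_sub, LinearMap.comp_apply, LinearMap.comp_apply, LinearMap.comp_apply,
    LinearMap.comp_apply, h1, level_qbd, level_toggle, level, proj_comm]

theorem qbd_defect (hup : ∀ S T, S ⊆ T → good S → good T) (x : FaceChain V) :
    qbd good (defect good k e x) = defect good k e (qbd good x) := by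
  simp only [defect, LinearMap.sub_apply, LinearMap.comp_apply, map_sub, qbd_proj hup,
    qbd_qbd hup, proj_qbd, map_zero]
  abel

/-- Below `k`, the defect strictly lowers `r`. -/
theorem defect_single_mem (hup : ∀ S T, S ⊆ T → good S → good T)
    (hmono : ∀ S T, good S → S ⊆ T → r S ≤ r T ∧ (r S = r T → e S = e T))
    (htog : ∀ S, good S → S.card < k →
      good (S.erase (e S)) ∧ r (S.erase (e S)) = r (insert (e S) S))
    {S : Finset V} (hS : good S) (hk : S.card < k) :
    defect good k e (Finsupp.single S 1) ∈ Submodule.span ℤ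
      {y | ∃ T, (good T ∧ T.card < k ∧ r T < r S) ∧ y = Finsupp.single T 1} := by
  have hsand : ∀ S, good S → S.card < k → good (S.erase (e S)) ∧ r (S.erase (e S)) = r S ∧
      r (insert (e S) S) = r S ∧ e (insert (e S) S) = e S := by
    intro S hS hk
    obtain ⟨h1, h2⟩ := htog S hS hk
    have h3 := hmono _ _ h1 (erase_subset (e S) S)
    have h4 := hmono _ _ hS (subset_insert (e S) S)
    exact ⟨h1, by omega, by omega, (h4.2 (by omega)).symm⟩
  obtain ⟨g1, g2, g3, g4⟩ := hsand S hS hk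
  set M := Submodule.span ℤ
      {y : FaceChain V | ∃ T, (good T ∧ T.card < k ∧ r T < r S) ∧ y = Finsupp.single T 1} with hM
  have hexp : defect good k e (Finsupp.single S 1) =
      ∑ s ∈ S, sgn s S • (proj good (wedge (e S) (Finsupp.single (S.erase s) 1)) -
        toggle good k e (Finsupp.single (S.erase s) 1)) := by
    have h1 := congrArg (proj good) (bd_wedge_add (e S) (Finsupp.single S 1))
    rw [map_add, ← qbd_apply] at h1
    rw [defect, LinearMap.sub_apply, LinearMap.sub_apply, LinearMap.comp_apply,
      LinearMap.comp_apply, toggle_single_of_pos hS hk, ← h1, qbd_apply good (Finsupp.single S 1),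
      toggle_proj, add_sub_cancel_left, bd_single]
    simp only [map_sum, map_smul, smul_sub, sum_sub_distrib]
  rw [hexp]
  refine Submodule.sum_mem _ fun s hs => Submodule.smul_mem _ _ ?_
  have hcard := card_erase_add_one hs
  have hk' : (S.erase s).card < k := by omega
  by_cases hT : good (S.erase s) ∧ r (S.erase s) = r S
  · have he : e (S.erase s) = e S := (hmono _ _ hT.1 (erase_subset s S)).2 hT.2
    rw [← toggle_proj, proj_single_of_pos hT.1, toggle_single_of_pos hT.1 hk', he]
    by_cases hm : e S ∈ S.erase s
    · simp [wedge_single_of_mem hm]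
    · rw [wedge_single_of_notMem hm, map_smul,
        proj_single_of_pos (hup _ _ (subset_insert _ _) hT.1), sub_self]
      exact zero_mem _
  · refine sub_mem ?_ ?_
    · by_cases hm : e S ∈ S.erase s
      · simp [wedge_single_of_mem hm]
      · rw [wedge_single_of_notMem hm, map_smul]
        refine Submodule.smul_mem _ _ ?_
        by_cases hg : good (insert (e S) (S.erase s))
        · rw [proj_single_of_pos hg]
          have hc : (insert (e S) (S.erase s)).card < k := by
            rw [card_insert_of_notMem hm]; omega
          have hle := hmono _ _ hg (insert_subset_insert (e S) (erase_subset s S))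
          rw [g3, g4] at hle
          refine Submodule.subset_span ⟨_, ⟨hg, hc, lt_of_le_of_ne hle.1 fun heq => hT ?_⟩, rfl⟩
          have h5 := hsand _ hg hc
          rw [hle.2 heq, erase_insert hm] at h5
          exact ⟨h5.1, h5.2.1.trans heq⟩
        · rw [proj_single_of_neg hg]
          exact zero_mem _
    · by_cases hg : good (S.erase s)
      · rw [toggle_single_of_pos hg hk']
        by_cases hm : e (S.erase s) ∈ S.erase s
        · simp [wedge_single_of_mem hm]
        · rw [wedge_single_of_notMem hm]
          refine Submodule.smul_mem _ _ (Submodule.subset_span ⟨_, ⟨?_, ?_, ?_⟩, rfl⟩)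
          · exact hup _ _ (subset_insert _ _) hg
          · rw [card_insert_of_notMem hm]; omega
          · rw [(hsand _ hg hk').2.2.1]
            exact lt_of_le_of_ne (hmono _ _ hg (erase_subset s S)).1 fun h => hT ⟨hg, h⟩
      · rw [toggle_single_of_neg fun h => hg h.1]
        exact zero_mem _

theorem defect_pow_single (hup : ∀ S T, S ⊆ T → good S → good T)
    (hmono : ∀ S T, good S → S ⊆ T → r S ≤ r T ∧ (r S = r T → e S = e T))
    (htog : ∀ S, good S → S.card < k →
      good (S.erase (e S)) ∧ r (S.erase (e S)) = r (insert (e S) S))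
    (n : ℕ) {S : Finset V} (hS : good S) (hk : S.card < k) (hn : r S < n) :
    (defect good k e ^ n) (Finsupp.single S 1) = 0 := by
  induction n generalizing S with
  | zero => omega
  | succ n ih =>
    rw [pow_succ, Module.End.mul_apply]
    have hmem := defect_single_mem hup hmono htog hS hk
    generalize defect good k e (Finsupp.single S 1) = x at hmem
    induction hmem using Submodule.span_induction with
    | mem y hy => obtain ⟨T, ⟨h1, h2, h3⟩, rfl⟩ := hy; exact ih h1 h2 (by omega)
    | zero => simp
    | add y z _ _ hy hz => rw [map_add, hy, hz, add_zero]
    | smul a y _ hy => rw [map_smul, hy, smul_zero]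

/-- A matching of the good faces with fewer than `k` vertices, given by toggling `e S` in `S`
and made acyclic by the function `r`, provides a contraction below `k`. -/
theorem contractibleBelow_of_matching [Finite V] (hup : ∀ S T, S ⊆ T → good S → good T)
    (hmono : ∀ S T, good S → S ⊆ T → r S ≤ r T ∧ (r S = r T → e S = e T))
    (htog : ∀ S, good S → S.card < k →
      good (S.erase (e S)) ∧ r (S.erase (e S)) = r (insert (e S) S)) :
    ContractibleBelow good k := by
  have := Fintype.ofFinite V
  set n := Finset.univ.sup r + 1
  have hn : ∀ S, r S < n := fun S => Nat.lt_succ_of_le (Finset.le_sup (Finset.mem_univ S))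
  set N := defect good k e with hN
  have hpow : ∀ (i : ℕ) (x : FaceChain V), qbd good ((N ^ i) x) = (N ^ i) (qbd good x) := by
    intro i
    induction i with
    | zero => simp
    | succ i ih => intro x; rw [pow_succ, Module.End.mul_apply, ih, qbd_defect hup]; rfl
  have hlev : ∀ (c i : ℕ) (x : FaceChain V), level c ((N ^ i) x) = (N ^ i) (level c x) := by
    intro c i
    induction i with
    | zero => simp
    | succ i ih => intro x; rw [pow_succ, Module.End.mul_apply, ih, level_defect]; rfl
  have hproj : ∀ (i : ℕ) (x : FaceChain V), proj good ((N ^ i) (proj good x)) =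
      (N ^ i) (proj good x) := by
    intro i
    cases i with
    | zero => intro x; simp [proj_proj]
    | succ i => intro x; rw [pow_succ', Module.End.mul_apply, proj_defect hup]
  refine ⟨toggle good k e ∘ₗ (∑ i ∈ range n, N ^ i) ∘ₗ proj good, fun x => ?_, fun x => ?_,
    fun c x => ?_, fun S hS hk => ?_⟩
  · simp only [LinearMap.comp_apply, proj_proj]
  · rw [LinearMap.comp_apply, proj_toggle hup]
  · simp only [LinearMap.comp_apply, level_toggle, LinearMap.sum_apply, map_sum, hlev]
    simp only [level, proj_comm good]
  · have hx := proj_single_of_pos hS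
    set x : FaceChain V := Finsupp.single S 1
    have hstep : ∀ i : ℕ, qbd good (toggle good k e ((N ^ i) x)) +
        toggle good k e ((N ^ i) (qbd good x)) = (N ^ i) x - (N ^ (i + 1)) x := by
      intro i
      have h1 : N ((N ^ i) x) = proj good ((N ^ i) x) - qbd good (toggle good k e ((N ^ i) x)) -
          toggle good k e (qbd good ((N ^ i) x)) := rfl
      have h2 := hproj i x
      rw [hx] at h2
      rw [h2, hpow] at h1
      rw [pow_succ', Module.End.mul_apply, h1]
      abel
    simp only [LinearMap.comp_apply, proj_qbd, hx, LinearMap.sum_apply, map_sum]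
    rw [← sum_add_distrib, sum_congr rfl fun i _ => hstep i,
      Finset.sum_range_sub' (fun i => (N ^ i) x),
      defect_pow_single hup hmono htog n hS hk (hn S)]
    simp

end Toggle

end Contraction

section Homology

variable {V : Type} {d : ℕ}

/-- The inclusion of the chains of degree `d` into the chains of all degrees. -/
def incl : Chain V d →ₗ[ℤ] FaceChain V := Finsupp.lmapDomain ℤ ℤ Subtype.val

/-- The component of degree `d`. -/
def component (d : ℕ) : FaceChain V →ₗ[ℤ] Chain V d :=
  Finsupp.lcomapDomain Subtype.val Subtype.val_injective

theorem incl_single (S : Gen V d) :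
    incl (Finsupp.single S 1) = Finsupp.single S.1 (1 : ℤ) := by
  simp [incl]

theorem chain_ext {M : Type} [AddCommGroup M] {f g : Chain V d →ₗ[ℤ] M}
    (h : ∀ S : Gen V d, f (Finsupp.single S 1) = g (Finsupp.single S 1)) : f = g := by
  apply Finsupp.lhom_ext'
  intro S
  ext
  simpa using h S

theorem incl_injective : Function.Injective (incl : Chain V d →ₗ[ℤ] FaceChain V) :=
  Finsupp.mapDomain_injective Subtype.val_injective

theorem incl_component (x : FaceChain V) : incl (component d x) = level (d + 1) x := by
  ext S
  rw [level, proj_apply]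
  by_cases hS : S.card = d + 1
  · rw [if_pos hS]
    exact (Finsupp.mapDomain_apply Subtype.val_injective _ (⟨S, hS⟩ : Gen V d)).trans rfl
  · rw [if_neg hS]
    refine Finsupp.mapDomain_of_notMem_range _ _ ?_
    rintro ⟨T, rfl⟩
    exact hS T.2

theorem level_incl (x : Chain V d) : level (d + 1) (incl x) = incl x := by
  suffices h : level (d + 1) ∘ₗ incl = (incl : Chain V d →ₗ[ℤ] FaceChain V) from
    LinearMap.congr_fun h x
  refine chain_ext fun S => ?_
  rw [LinearMap.comp_apply, incl_single, level]
  exact proj_single_of_pos (p := fun T => T.card = d + 1) S.2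

theorem mem_badChains_iff {good : Finset V → Prop} {x : Chain V d} :
    x ∈ badChains V good d ↔ proj good (incl x) = 0 := by
  constructor
  · intro h
    rw [badChains] at h
    induction h using Submodule.span_induction with
    | mem y hy => obtain ⟨S, hS, rfl⟩ := hy; rw [incl_single, proj_single_of_neg hS]
    | zero => simp
    | add y z _ _ hy hz => rw [map_add, map_add, hy, hz, add_zero]
    | smul a y _ hy => rw [map_smul, map_smul, hy, smul_zero]
  · intro h
    rw [← Finsupp.sum_single x]
    refine Submodule.sum_mem _ fun S hS => ?_
    have hbad : ¬ good S.1 := by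
      intro hg
      have h1 := DFunLike.congr_fun h S.1
      rw [proj_apply, if_pos hg] at h1
      exact Finsupp.mem_support_iff.1 hS
        ((Finsupp.mapDomain_apply Subtype.val_injective x S).symm.trans h1)
    have : (Finsupp.single S (x S) : Chain V d) = x S • Finsupp.single S 1 := by simp
    rw [this]
    exact Submodule.smul_mem _ _ (Submodule.subset_span ⟨S, hbad, rfl⟩)

variable [LinearOrder V] {good : Finset V → Prop}

theorem proj_incl_bdry (hempty : ¬ good ∅) (x : Chain V d) :
    proj good (incl (bdry V d x)) = qbd good (incl x) := by
  suffices h : proj good ∘ₗ incl ∘ₗ bdry V d = qbd good ∘ₗ incl from LinearMap.congr_fun h x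
  refine chain_ext fun S => ?_
  simp only [LinearMap.comp_apply, incl_single, qbd_apply, bd_single]
  simp only [bdry, Finsupp.lift_apply, Finsupp.sum_single_index, zero_smul, one_smul, map_sum,
    map_smul]
  refine sum_congr rfl fun s hs => ?_
  rw [sgn]
  congr 1
  by_cases h : (S.1.erase s).card = d - 1 + 1
  · rw [dif_pos h, incl_single]
  · rw [dif_neg h, map_zero, map_zero, proj_single_of_neg]
    have h1 := card_erase_add_one hs
    have h2 := S.2
    have h3 : S.1.erase s = ∅ := by
      rw [← card_eq_zero]; omega
    rwa [h3]

theorem mem_cycles_iff (hempty : ¬ good ∅) {x : Chain V d} :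
    x ∈ cycles V good d ↔ qbd good (incl x) = 0 := by
  rw [cycles, Submodule.mem_comap, mem_badChains_iff, proj_incl_bdry hempty]

theorem mem_boundaries_iff (hempty : ¬ good ∅) {x : Chain V d} :
    x ∈ badChains V good d ⊔ LinearMap.range (bdry V (d + 1)) ↔
      ∃ w, proj good (incl x) = qbd good w := by
  constructor
  · intro h
    obtain ⟨b, hb, c, ⟨w, rfl⟩, rfl⟩ := Submodule.mem_sup.1 h
    refine ⟨incl w, ?_⟩
    rw [map_add, map_add, mem_badChains_iff.1 hb, zero_add]
    exact proj_incl_bdry hempty w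
  · rintro ⟨w, hw⟩
    have h2 := proj_incl_bdry hempty (component (d + 1) w)
    rw [incl_component, ← level_qbd, ← hw, level, proj_comm] at h2
    let c : Chain V d := bdry V (d + 1) (component (d + 1) w)
    have h1 : x - c ∈ badChains V good d := by
      rw [mem_badChains_iff, map_sub, map_sub]
      refine sub_eq_zero.2 (Eq.trans ?_ h2.symm)
      exact congrArg (proj good) (level_incl x).symm
    rw [← sub_add_cancel x c]
    exact Submodule.add_mem_sup h1 ⟨_, rfl⟩

theorem mk_eq_mk_iff (hempty : ¬ good ∅) {x y : cycles V good d} :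
    (Submodule.Quotient.mk x : homology V good d) = Submodule.Quotient.mk y ↔
      ∃ w, proj good (incl x.1) - proj good (incl y.1) = qbd good w := by
  rw [Submodule.Quotient.eq, Submodule.mem_comap, mem_boundaries_iff hempty]
  simp

end Homology

section Truncation

variable {V : Type} [LinearOrder V]

/-- A chain endomorphism `E` of the quotient complex, homotopic to the identity through `h` and
vanishing on the faces with fewer than `k` vertices. -/
structure IsTruncation (good : Finset V → Prop) (k : ℕ) (E h : FaceChain V →ₗ[ℤ] FaceChain V) :
    Prop where
  hom_proj : ∀ x, h (proj good x) = h x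
  proj_hom : ∀ x, proj good (h x) = h x
  level_hom : ∀ c x, level (c + 1) (h x) = h (level c x)
  map_eq : ∀ x, E x = proj good x - qbd good (h x) - h (qbd good x)
  map_of_card_lt : ∀ S : Finset V, S.card < k → E (Finsupp.single S 1) = 0

variable {good : Finset V → Prop} {k p : ℕ} {E h : FaceChain V →ₗ[ℤ] FaceChain V}

theorem ContractibleBelow.exists_isTruncation (hup : ∀ S T, S ⊆ T → good S → good T)
    (hc : ContractibleBelow good k) : ∃ E h, IsTruncation good k E h := by
  obtain ⟨h, h1, h2, h3, h4⟩ := hc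
  refine ⟨proj good - qbd good ∘ₗ h - h ∘ₗ qbd good, h, h1, h2, h3, fun x => rfl, fun S hS => ?_⟩
  simp only [LinearMap.sub_apply, LinearMap.comp_apply]
  by_cases hg : good S
  · rw [proj_single_of_pos hg, sub_sub, h4 S hg hS, sub_self]
  · rw [← h1, ← qbd_proj hup (Finsupp.single S 1), proj_single_of_neg hg]
    simp

namespace IsTruncation

theorem map_proj (hE : IsTruncation good k E h) (hup : ∀ S T, S ⊆ T → good S → good T) (x : FaceChain V) :
    E (proj good x) = E x := by
  rw [hE.map_eq, hE.map_eq, proj_proj, hE.hom_proj, qbd_proj hup]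

theorem proj_map (hE : IsTruncation good k E h) (x : FaceChain V) : proj good (E x) = E x := by
  rw [hE.map_eq, map_sub, map_sub, proj_proj, proj_qbd, hE.proj_hom]

theorem qbd_map (hE : IsTruncation good k E h) (hup : ∀ S T, S ⊆ T → good S → good T) (x : FaceChain V) :
    qbd good (E x) = E (qbd good x) := by
  rw [hE.map_eq, hE.map_eq, map_sub, map_sub, qbd_proj hup, qbd_qbd hup, qbd_qbd hup, proj_qbd,
    map_zero]
  abel

theorem level_map (hE : IsTruncation good k E h) (c : ℕ) (x : FaceChain V) : level (c + 1) (E x) = E (level (c + 1) x) := by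
  rw [hE.map_eq, hE.map_eq, map_sub, map_sub, level_qbd, hE.level_hom, hE.level_hom, level_qbd,
    level, proj_comm]

theorem parity_hom (hE : IsTruncation good k E h) (x : FaceChain V) : parity (h x) = - h (parity x) :=
  parity_anticomm hE.level_hom x

theorem parity_map (hE : IsTruncation good k E h) (x : FaceChain V) : parity (E x) = E (parity x) := by
  have h1 : ∀ y, parity (qbd good y) = - qbd good (parity y) := fun y => by
    rw [qbd_parity, neg_neg]
  rw [hE.map_eq, hE.map_eq, map_sub, map_sub, proj_parity, h1, hE.parity_hom, hE.parity_hom, h1]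
  simp

theorem map_level_of_lt (hE : IsTruncation good k E h) {c : ℕ} (hc : c < k) (x : FaceChain V) : E (level c x) = 0 := by
  suffices h : E ∘ₗ level c = 0 from LinearMap.congr_fun h x
  refine total_ext fun S => ?_
  rw [LinearMap.comp_apply, level]
  by_cases hS : S.card = c
  · rw [proj_single_of_pos (p := fun T => T.card = c) hS, hE.map_of_card_lt S (by omega)]
    rfl
  · rw [proj_single_of_neg (p := fun T => T.card = c) hS, map_zero, LinearMap.zero_apply]

end IsTruncation

theorem IsTruncation.component_map_mem_cycles (hE : IsTruncation good (p + 1) E h)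
    (hup : ∀ S T, S ⊆ T → good S → good T) (hempty : ¬ good ∅) (x : FaceChain V) :
    component p (E x) ∈ cycles V good p := by
  rw [mem_cycles_iff hempty, incl_component, hE.level_map, hE.qbd_map hup, ← level_qbd,
    hE.map_level_of_lt (Nat.lt_succ_self p)]

/-- The cycle of degree `p` obtained by truncating a chain. -/
def truncCycle (hE : IsTruncation good (p + 1) E h) (hup : ∀ S T, S ⊆ T → good S → good T)
    (hempty : ¬ good ∅) : FaceChain V →ₗ[ℤ] cycles V good p :=
  (component p ∘ₗ E).codRestrict _ (hE.component_map_mem_cycles hup hempty)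

/-- The homology class of degree `p` obtained by truncating a chain. -/
def truncClass (hE : IsTruncation good (p + 1) E h) (hup : ∀ S T, S ⊆ T → good S → good T)
    (hempty : ¬ good ∅) : FaceChain V →ₗ[ℤ] homology V good p :=
  Submodule.mkQ _ ∘ₗ truncCycle hE hup hempty

section

variable (hE : IsTruncation good (p + 1) E h) (hup : ∀ S T, S ⊆ T → good S → good T)
  (hempty : ¬ good ∅)

theorem incl_truncCycle (x : FaceChain V) :
    incl (truncCycle hE hup hempty x).1 = level (p + 1) (E x) :=
  incl_component (E x)

theorem truncClass_proj (x : FaceChain V) :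
    truncClass hE hup hempty (proj good x) = truncClass hE hup hempty x := by
  have h1 : truncCycle hE hup hempty (proj good x) = truncCycle hE hup hempty x := by
    apply Subtype.ext
    apply incl_injective
    rw [incl_truncCycle, incl_truncCycle, hE.map_proj hup]
  rw [truncClass, LinearMap.comp_apply, h1, LinearMap.comp_apply]

theorem truncClass_bd (x : FaceChain V) : truncClass hE hup hempty (bd x) = 0 := by
  rw [← truncClass_proj, ← qbd_apply, truncClass, LinearMap.comp_apply, Submodule.mkQ_apply,
    Submodule.Quotient.mk_eq_zero, Submodule.mem_comap, mem_boundaries_iff hempty]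
  refine ⟨level (p + 2) (E x), ?_⟩
  rw [Submodule.subtype_apply, incl_truncCycle, ← hE.qbd_map hup, level_qbd, proj_qbd]

theorem truncClass_incl {x : Chain V p} (hx : x ∈ cycles V good p) :
    truncClass hE hup hempty (incl x) = Submodule.Quotient.mk ⟨x, hx⟩ := by
  rw [truncClass, LinearMap.comp_apply, Submodule.mkQ_apply, mk_eq_mk_iff hempty]
  refine ⟨- h (incl x), ?_⟩
  rw [incl_truncCycle, hE.level_map, level_incl, hE.proj_map, hE.map_eq,
    (mem_cycles_iff hempty).1 hx, map_zero, map_neg]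
  abel

end

end Truncation

section Join

variable {V W : Type}

/-- The bilinear join of chains of all degrees. -/
def joinChain : FaceChain V →ₗ[ℤ] FaceChain W →ₗ[ℤ] FaceChain (V ⊕ W) :=
  Finsupp.linearCombination ℤ fun S => Finsupp.linearCombination ℤ fun T =>
    Finsupp.single (S.disjSum T) 1

theorem joinChain_single (S : Finset V) (T : Finset W) :
    joinChain (Finsupp.single S 1) (Finsupp.single T 1) =
      Finsupp.single (S.disjSum T) (1 : ℤ) := by
  simp [joinChain]

theorem bilinear_ext {M : Type} [AddCommGroup M] {f g : FaceChain V →ₗ[ℤ] FaceChain W →ₗ[ℤ] M}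
    (h : ∀ (S : Finset V) (T : Finset W), f (Finsupp.single S 1) (Finsupp.single T 1) =
      g (Finsupp.single S 1) (Finsupp.single T 1)) : f = g :=
  total_ext fun S => total_ext fun T => h S T

theorem joinChain_ext {M : Type} [AddCommGroup M] {f g : FaceChain (V ⊕ W) →ₗ[ℤ] M}
    (h : ∀ x y, f (joinChain x y) = g (joinChain x y)) : f = g := by
  refine total_ext fun U => ?_
  rw [← toLeft_disjSum_toRight (u := U), ← joinChain_single]
  exact h _ _

theorem proj_joinChain {g' : Finset V → Prop} {g'' : Finset W → Prop}
    {g : Finset (V ⊕ W) → Prop} (hg : ∀ S T, g (S.disjSum T) ↔ g' S ∧ g'' T)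
    (x : FaceChain V) (y : FaceChain W) :
    proj g (joinChain x y) = joinChain (proj g' x) (proj g'' y) := by
  suffices h : joinChain.compr₂ (proj g) = joinChain.compl₁₂ (proj g') (proj g'') from
    LinearMap.congr_fun₂ h x y
  refine bilinear_ext fun S T => ?_
  simp only [LinearMap.compr₂_apply, LinearMap.compl₁₂_apply, joinChain_single, proj_single]
  by_cases h1 : g' S <;> by_cases h2 : g'' T <;> simp [h1, h2, hg, joinChain_single]

/-- The linear map on the chains on `V ⊕ W` induced by a bilinear map on joins. -/
def onJoin {M : Type} [AddCommGroup M] (b : FaceChain V →ₗ[ℤ] FaceChain W →ₗ[ℤ] M) :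
    FaceChain (V ⊕ W) →ₗ[ℤ] M :=
  Finsupp.linearCombination ℤ fun U => b (Finsupp.single U.toLeft 1) (Finsupp.single U.toRight 1)

theorem onJoin_joinChain {M : Type} [AddCommGroup M]
    (b : FaceChain V →ₗ[ℤ] FaceChain W →ₗ[ℤ] M) (x : FaceChain V) (y : FaceChain W) :
    onJoin b (joinChain x y) = b x y := by
  suffices h : joinChain.compr₂ (onJoin b) = b from LinearMap.congr_fun₂ h x y
  refine bilinear_ext fun S T => ?_
  simp [joinChain_single, onJoin]

theorem erase_disjSum_inl [DecidableEq V] [DecidableEq (V ⊕ W)] (s : V) (S : Finset V) (T : Finset W) :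
    (S.disjSum T).erase (Sum.inl s) = (S.erase s).disjSum T := by
  ext u
  rcases u with u | u <;> simp

theorem erase_disjSum_inr [DecidableEq W] [DecidableEq (V ⊕ W)] (t : W) (S : Finset V) (T : Finset W) :
    (S.disjSum T).erase (Sum.inr t) = S.disjSum (T.erase t) := by
  ext u
  rcases u with u | u <;> simp

variable [LinearOrder V] [LinearOrder W]

/-- The strict order of `sumLinearOrder`. -/
abbrev sumLT (a b : V ⊕ W) : Prop :=
  @LT.lt (V ⊕ W) (sumLinearOrder V W).toPartialOrder.toPreorder.toLT a b

theorem sumLT_inl_inl {a b : V} : sumLT (Sum.inl a : V ⊕ W) (Sum.inl b) ↔ a < b :=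
  Sum.Lex.inl_lt_inl_iff

theorem sumLT_inr_inr {a b : W} : sumLT (Sum.inr a : V ⊕ W) (Sum.inr b) ↔ a < b :=
  Sum.Lex.inr_lt_inr_iff

theorem sumLT_inl_inr (a : V) (b : W) : sumLT (Sum.inl a : V ⊕ W) (Sum.inr b) :=
  Sum.Lex.inl_lt_inr a b

theorem not_sumLT_inr_inl (a : W) (b : V) : ¬ sumLT (Sum.inr a : V ⊕ W) (Sum.inl b) :=
  Sum.Lex.not_inr_lt_inl

theorem sgn_inl (s : V) (S : Finset V) (T : Finset W) :
    sgn (Sum.inl s) (S.disjSum T) = sgn s S := by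
  rw [sgn, sgn]
  congr 1
  rw [← card_map (f := (Function.Embedding.inl : V ↪ V ⊕ W))]
  congr 1
  ext u
  rcases u with u | u
  · simpa using fun _ => sumLT_inl_inl
  · simpa using fun _ => not_sumLT_inr_inl u s

theorem sgn_inr (t : W) (S : Finset V) (T : Finset W) :
    sgn (Sum.inr t) (S.disjSum T) = (-1) ^ S.card * sgn t T := by
  rw [sgn, sgn, ← pow_add, ← card_disjSum]
  congr 2
  ext u
  rcases u with u | u
  · simpa using fun _ => sumLT_inl_inr u t
  · simpa using fun _ => sumLT_inr_inr

theorem bd_joinChain (x : FaceChain V) (y : FaceChain W) :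
    bd (joinChain x y) = joinChain (bd x) y + joinChain (parity x) (bd y) := by
  suffices h : joinChain.compr₂ bd = joinChain.comp (bd : FaceChain V →ₗ[ℤ] FaceChain V) +
      joinChain.compl₁₂ parity (bd : FaceChain W →ₗ[ℤ] FaceChain W) from
    LinearMap.congr_fun₂ h x y
  refine bilinear_ext fun S T => ?_
  simp only [LinearMap.compr₂_apply, LinearMap.compl₁₂_apply, LinearMap.add_apply,
    LinearMap.comp_apply, joinChain_single, bd_single, sum_disjSum, parity_single, map_sum,
    map_smul, LinearMap.sum_apply, LinearMap.smul_apply, smul_smul, sgn_inl, sgn_inr]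
  congr 1
  · refine sum_congr rfl fun s _ => ?_
    rw [@erase_disjSum_inl _ _ _ (_)]
  · refine sum_congr rfl fun t _ => ?_
    rw [@erase_disjSum_inr _ _ _ (_), mul_comm]

theorem qbd_joinChain {g' : Finset V → Prop} {g'' : Finset W → Prop}
    {g : Finset (V ⊕ W) → Prop} (hg : ∀ S T, g (S.disjSum T) ↔ g' S ∧ g'' T)
    (x : FaceChain V) (y : FaceChain W) :
    qbd g (joinChain x y) = joinChain (qbd g' x) (proj g'' y) +
      joinChain (parity (proj g' x)) (qbd g'' y) := by
  rw [qbd_apply, bd_joinChain, map_add, proj_joinChain hg, proj_joinChain hg, proj_parity]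
  rfl

end Join

section Kunneth

variable {V W : Type} [LinearOrder V] [LinearOrder W] {g' : Finset V → Prop}
  {g'' : Finset W → Prop} {g : Finset (V ⊕ W) → Prop} {k l : ℕ}
  {E' h' : FaceChain V →ₗ[ℤ] FaceChain V} {E'' h'' : FaceChain W →ₗ[ℤ] FaceChain W}

/-- The tensor product of two truncations is homotopic to the identity. -/
theorem exists_homotopy_joinChain (hg : ∀ S T, g (S.disjSum T) ↔ g' S ∧ g'' T)
    (hup' : ∀ S T, S ⊆ T → g' S → g' T) (hup'' : ∀ S T, S ⊆ T → g'' S → g'' T)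
    (hE' : IsTruncation g' k E' h') (hE'' : IsTruncation g'' l E'' h'') :
    ∃ H : FaceChain (V ⊕ W) →ₗ[ℤ] FaceChain (V ⊕ W), ∀ z,
      proj g z - onJoin (joinChain.compl₁₂ E' E'') z = qbd g (H z) + H (qbd g z) := by
  set H : FaceChain (V ⊕ W) →ₗ[ℤ] FaceChain (V ⊕ W) := onJoin
    (joinChain.compl₁₂ h' (proj g'') + joinChain.compl₁₂ (parity ∘ₗ E') h'') with hH
  have hHJ : ∀ x y, H (joinChain x y) =
      joinChain (h' x) (proj g'' y) + joinChain (parity (E' x)) (h'' y) := fun x y => by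
    rw [hH, onJoin_joinChain]; rfl
  refine ⟨H, fun z => ?_⟩
  suffices h : proj g - onJoin (joinChain.compl₁₂ E' E'') = qbd g ∘ₗ H + H ∘ₗ qbd g from
    LinearMap.congr_fun h z
  refine joinChain_ext fun x y => ?_
  rw [LinearMap.sub_apply, onJoin_joinChain, LinearMap.compl₁₂_apply, LinearMap.add_apply,
    LinearMap.comp_apply, LinearMap.comp_apply, hHJ, qbd_joinChain hg, map_add, map_add,
    qbd_joinChain hg, qbd_joinChain hg, hHJ, hHJ, proj_joinChain hg]
  have e1 : qbd g'' (proj g'' y) = qbd g'' y := qbd_proj hup'' y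
  have e2 : qbd g' (parity (E' x)) = - parity (E' (qbd g' x)) := by
    rw [qbd_parity, hE'.qbd_map hup']
  have e3 : parity (proj g' (parity (E' x))) = E' x := by
    rw [proj_parity, parity_parity, hE'.proj_map]
  have e4 : h' (parity (proj g' x)) = - parity (h' x) := by
    rw [hE'.parity_hom, neg_neg, ← proj_parity, hE'.hom_proj]
  have e5 : parity (E' (parity (proj g' x))) = E' x := by
    rw [hE'.parity_map, parity_parity, hE'.map_proj hup']
  have e6 : proj g' x = E' x + qbd g' (h' x) + h' (qbd g' x) := by
    rw [hE'.map_eq]; abel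
  have e7 : proj g'' y = E'' y + qbd g'' (h'' y) + h'' (qbd g'' y) := by
    rw [hE''.map_eq]; abel
  rw [proj_proj, e1, hE'.proj_hom, e2, hE''.proj_hom, e3, proj_qbd, hE''.hom_proj, e4, e5,
    LinearMap.map_neg₂, LinearMap.map_neg₂]
  conv_lhs => rw [e6]
  rw [map_add, map_add, LinearMap.add_apply, LinearMap.add_apply]
  have e8 : joinChain (E' x) (proj g'' y) = joinChain (E' x) (E'' y) +
      joinChain (E' x) (qbd g'' (h'' y)) + joinChain (E' x) (h'' (qbd g'' y)) := by
    conv_lhs => rw [e7]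
    rw [map_add, map_add]
  rw [e8]
  abel

variable {p q : ℕ} {J : Chain V p →ₗ[ℤ] Chain W q →ₗ[ℤ] Chain (V ⊕ W) (p + q + 1)}

theorem join_mem_cycles (hg : ∀ S T, g (S.disjSum T) ↔ g' S ∧ g'' T)
    (hempty' : ¬ g' ∅) (hempty'' : ¬ g'' ∅) (hempty : ¬ g ∅)
    (hJ : ∀ x y, incl (J x y) = joinChain (incl x) (incl y))
    {x : Chain V p} (hx : x ∈ cycles V g' p) {y : Chain W q} (hy : y ∈ cycles W g'' q) :
    J x y ∈ cycles (V ⊕ W) g (p + q + 1) := by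
  rw [mem_cycles_iff hempty, hJ, qbd_joinChain hg, (mem_cycles_iff hempty').1 hx,
    (mem_cycles_iff hempty'').1 hy]
  simp

theorem join_mem_boundaries_left (hg : ∀ S T, g (S.disjSum T) ↔ g' S ∧ g'' T)
    (hempty' : ¬ g' ∅) (hempty'' : ¬ g'' ∅) (hempty : ¬ g ∅)
    (hJ : ∀ x y, incl (J x y) = joinChain (incl x) (incl y))
    {x : Chain V p} (hx : x ∈ badChains V g' p ⊔ LinearMap.range (bdry V (p + 1)))
    {y : Chain W q} (hy : y ∈ cycles W g'' q) :
    J x y ∈ badChains (V ⊕ W) g (p + q + 1) ⊔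
      LinearMap.range (bdry (V ⊕ W) (p + q + 1 + 1)) := by
  obtain ⟨w, hw⟩ := (mem_boundaries_iff hempty').1 hx
  rw [mem_boundaries_iff hempty]
  refine ⟨joinChain w (incl y), ?_⟩
  rw [hJ, proj_joinChain hg, hw, qbd_joinChain hg, (mem_cycles_iff hempty'').1 hy, map_zero,
    add_zero]

theorem join_mem_boundaries_right (hg : ∀ S T, g (S.disjSum T) ↔ g' S ∧ g'' T)
    (hempty' : ¬ g' ∅) (hempty'' : ¬ g'' ∅) (hempty : ¬ g ∅)
    (hJ : ∀ x y, incl (J x y) = joinChain (incl x) (incl y))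
    {x : Chain V p} (hx : x ∈ cycles V g' p)
    {y : Chain W q} (hy : y ∈ badChains W g'' q ⊔ LinearMap.range (bdry W (q + 1))) :
    J x y ∈ badChains (V ⊕ W) g (p + q + 1) ⊔
      LinearMap.range (bdry (V ⊕ W) (p + q + 1 + 1)) := by
  obtain ⟨w, hw⟩ := (mem_boundaries_iff hempty'').1 hy
  rw [mem_boundaries_iff hempty]
  refine ⟨joinChain (parity (incl x)) w, ?_⟩
  rw [hJ, proj_joinChain hg, hw, qbd_joinChain hg, qbd_parity, (mem_cycles_iff hempty').1 hx,
    proj_parity, parity_parity, map_zero, neg_zero, map_zero, LinearMap.zero_apply, zero_add]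

/-- The join, as a bilinear map on cycles with values in homology. -/
def joinCycles (J : Chain V p →ₗ[ℤ] Chain W q →ₗ[ℤ] Chain (V ⊕ W) (p + q + 1))
    (hcyc : ∀ x ∈ cycles V g' p, ∀ y ∈ cycles W g'' q, J x y ∈ cycles (V ⊕ W) g (p + q + 1)) :
    cycles V g' p →ₗ[ℤ] cycles W g'' q →ₗ[ℤ] cycles (V ⊕ W) g (p + q + 1) :=
  LinearMap.mk₂ ℤ (fun x y => ⟨J x.1 y.1, hcyc x.1 x.2 y.1 y.2⟩)
    (fun _ _ _ => Subtype.ext (by simp)) (fun _ _ _ => Subtype.ext (by simp))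
    (fun _ _ _ => Subtype.ext (by simp)) (fun _ _ _ => Subtype.ext (by simp))

/-- Joins induce an isomorphism from the tensor product of the homology groups of two quotient
complexes, each contractible below the degree considered, to the homology of their join. -/
theorem exists_kunneth_equiv (hg : ∀ S T, g (S.disjSum T) ↔ g' S ∧ g'' T)
    (hup' : ∀ S T, S ⊆ T → g' S → g' T) (hup'' : ∀ S T, S ⊆ T → g'' S → g'' T)
    (hempty' : ¬ g' ∅) (hempty'' : ¬ g'' ∅) (hempty : ¬ g ∅)
    (hJ : ∀ x y, incl (J x y) = joinChain (incl x) (incl y))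
    (hc' : ContractibleBelow g' (p + 1)) (hc'' : ContractibleBelow g'' (q + 1)) :
    ∃ Φ : homology V g' p ⊗[ℤ] homology W g'' q ≃ₗ[ℤ] homology (V ⊕ W) g (p + q + 1),
      ∀ (x : Chain V p) (hx : x ∈ cycles V g' p) (y : Chain W q) (hy : y ∈ cycles W g'' q),
        Φ (Submodule.Quotient.mk ⟨x, hx⟩ ⊗ₜ[ℤ] Submodule.Quotient.mk ⟨y, hy⟩) =
          cls (V ⊕ W) g (p + q + 1) (J x y) := by
  obtain ⟨E', h', hE'⟩ := hc'.exists_isTruncation hup'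
  obtain ⟨E'', h'', hE''⟩ := hc''.exists_isTruncation hup''
  have hcyc : ∀ x ∈ cycles V g' p, ∀ y ∈ cycles W g'' q,
      J x y ∈ cycles (V ⊕ W) g (p + q + 1) := fun x hx y hy =>
    join_mem_cycles hg hempty' hempty'' hempty hJ hx hy
  let B := (joinCycles J hcyc).compr₂ (Submodule.mkQ (Submodule.comap
    (cycles (V ⊕ W) g (p + q + 1)).subtype (badChains (V ⊕ W) g (p + q + 1) ⊔
      LinearMap.range (bdry (V ⊕ W) (p + q + 1 + 1)))))
  have hB : ∀ x y, B x y = 0 ↔ J x.1 y.1 ∈ badChains (V ⊕ W) g (p + q + 1) ⊔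
      LinearMap.range (bdry (V ⊕ W) (p + q + 1 + 1)) := fun x y =>
    (Submodule.Quotient.mk_eq_zero _).trans Iff.rfl
  let B₁ : homology W g'' q →ₗ[ℤ] cycles V g' p →ₗ[ℤ] homology (V ⊕ W) g (p + q + 1) :=
    Submodule.liftQ _ B.flip fun y hy => by
      refine LinearMap.mem_ker.2 (LinearMap.ext fun x => ?_)
      exact (hB x y).2 (join_mem_boundaries_right hg hempty' hempty'' hempty hJ x.2 hy)
  let B₂ : homology V g' p →ₗ[ℤ] homology W g'' q →ₗ[ℤ] homology (V ⊕ W) g (p + q + 1) :=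
    Submodule.liftQ _ B₁.flip fun x hx => by
      refine LinearMap.mem_ker.2 (LinearMap.ext fun y => ?_)
      obtain ⟨y, rfl⟩ := Submodule.Quotient.mk_surjective _ y
      exact (hB x y).2 (join_mem_boundaries_left hg hempty' hempty'' hempty hJ hx y.2)
  let Φ := TensorProduct.lift B₂
  have hΦ : ∀ (x : cycles V g' p) (y : cycles W g'' q),
      Φ (Submodule.Quotient.mk x ⊗ₜ[ℤ] Submodule.Quotient.mk y) =
        Submodule.Quotient.mk (joinCycles J hcyc x y) := fun x y => rfl
  let Ψ : FaceChain (V ⊕ W) →ₗ[ℤ] homology V g' p ⊗[ℤ] homology W g'' q :=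
    onJoin ((TensorProduct.mk ℤ _ _).compl₁₂ (truncClass hE' hup' hempty')
      (truncClass hE'' hup'' hempty''))
  have hΨJ : ∀ x y, Ψ (joinChain x y) =
      truncClass hE' hup' hempty' x ⊗ₜ[ℤ] truncClass hE'' hup'' hempty'' y := fun x y =>
    onJoin_joinChain _ x y
  have hΨproj : ∀ z, Ψ (proj g z) = Ψ z := by
    intro z
    suffices h : Ψ ∘ₗ proj g = Ψ from LinearMap.congr_fun h z
    refine joinChain_ext fun x y => ?_
    rw [LinearMap.comp_apply, proj_joinChain hg, hΨJ, hΨJ, truncClass_proj, truncClass_proj]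
  have hΨqbd : ∀ z, Ψ (qbd g z) = 0 := by
    intro z
    rw [qbd_apply, hΨproj]
    suffices h : Ψ ∘ₗ bd = 0 from LinearMap.congr_fun h z
    refine joinChain_ext fun x y => ?_
    rw [LinearMap.comp_apply, bd_joinChain, map_add, hΨJ, hΨJ, truncClass_bd, truncClass_bd]
    simp
  let Ψ₁ : homology (V ⊕ W) g (p + q + 1) →ₗ[ℤ] homology V g' p ⊗[ℤ] homology W g'' q :=
    Submodule.liftQ _ (Ψ ∘ₗ incl ∘ₗ Submodule.subtype _) fun z hz => by
      obtain ⟨w, hw⟩ := (mem_boundaries_iff hempty).1 (Submodule.mem_comap.1 hz)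
      rw [LinearMap.mem_ker]
      change Ψ (incl z.1) = 0
      rw [← hΨproj]
      exact (congrArg Ψ hw).trans (hΨqbd w)
  have hleft : Ψ₁ ∘ₗ Φ = LinearMap.id := by
    refine TensorProduct.ext' fun a b => ?_
    obtain ⟨x, rfl⟩ := Submodule.Quotient.mk_surjective _ a
    obtain ⟨y, rfl⟩ := Submodule.Quotient.mk_surjective _ b
    rw [LinearMap.comp_apply, hΦ]
    change Ψ (incl (J x.1 y.1)) = _
    rw [hJ, hΨJ, truncClass_incl _ _ _ x.2, truncClass_incl _ _ _ y.2]
    rfl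
  have hsurj : Function.Surjective Φ := by
    intro a
    obtain ⟨z, rfl⟩ := Submodule.Quotient.mk_surjective _ a
    let G : FaceChain (V ⊕ W) →ₗ[ℤ] cycles (V ⊕ W) g (p + q + 1) :=
      onJoin ((joinCycles J hcyc).compl₁₂ (truncCycle hE' hup' hempty')
        (truncCycle hE'' hup'' hempty''))
    have hGΦ : ∀ x, (Submodule.Quotient.mk (G x) : homology (V ⊕ W) g (p + q + 1)) =
        Φ (Ψ x) := by
      intro x
      suffices h : Submodule.mkQ _ ∘ₗ G = Φ ∘ₗ Ψ from LinearMap.congr_fun h x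
      refine joinChain_ext fun x y => ?_
      change Submodule.Quotient.mk (G (joinChain x y)) = Φ (Ψ (joinChain x y))
      have hG : G (joinChain x y) = joinCycles J hcyc (truncCycle hE' hup' hempty' x)
        (truncCycle hE'' hup'' hempty'' y) := onJoin_joinChain _ x y
      rw [hΨJ, hG]
      rfl
    have hGE : ∀ x, incl (G (level (p + q + 1 + 1) x)).1 =
        onJoin (joinChain.compl₁₂ E' E'') (level (p + q + 1 + 1) x) := by
      intro x
      suffices h : (incl ∘ₗ Submodule.subtype _ ∘ₗ G) ∘ₗ level (p + q + 1 + 1) =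
          onJoin (joinChain.compl₁₂ E' E'') ∘ₗ level (p + q + 1 + 1) from
        LinearMap.congr_fun h x
      refine total_ext fun U => ?_
      rw [LinearMap.comp_apply, LinearMap.comp_apply (f := onJoin _), level]
      by_cases hU : U.card = p + q + 1 + 1
      · rw [proj_single_of_pos (p := fun T => T.card = p + q + 1 + 1) hU,
          ← toLeft_disjSum_toRight (u := U), ← joinChain_single, onJoin_joinChain,
          LinearMap.comp_apply, LinearMap.comp_apply (g := G), onJoin_joinChain]
        change incl (J _ _) = joinChain _ _
        rw [hJ, incl_truncCycle, incl_truncCycle, hE'.level_map, hE''.level_map]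
        have hcard := card_toLeft_add_card_toRight (u := U)
        rcases lt_trichotomy U.toLeft.card (p + 1) with h | h | h
        · have h1 := hE'.map_of_card_lt _ h
          rw [h1, level, proj_single_of_neg (by simpa using h.ne), map_zero, map_zero]
          rfl
        · rw [level, level, proj_single_of_pos h,
            proj_single_of_pos (p := fun T => T.card = q + 1) (by omega)]
        · have h2 : U.toRight.card < q + 1 := by omega
          have h1 := hE''.map_of_card_lt _ h2
          rw [h1, level, level, proj_single_of_neg (S := U.toRight) (by simpa using h2.ne),
            map_zero, map_zero, map_zero]
      · rw [proj_single_of_neg (p := fun T => T.card = p + q + 1 + 1) hU, map_zero, map_zero]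
    obtain ⟨H, hH⟩ := exists_homotopy_joinChain hg hup' hup'' hE' hE''
    refine ⟨Ψ (incl z.1), ?_⟩
    rw [← hGΦ]
    symm
    refine (mk_eq_mk_iff hempty).2 ⟨H (incl z.1), ?_⟩
    have h1 := hGE (incl z.1)
    rw [level_incl] at h1
    have h2 := hH (incl z.1)
    rw [(mem_cycles_iff hempty).1 z.2, map_zero, add_zero, ← h1] at h2
    have h3 := congrArg (proj g) h2
    rwa [map_sub, proj_proj, proj_qbd] at h3
  refine ⟨LinearEquiv.ofBijective Φ
    ⟨fun a b hab => ?_, hsurj⟩, fun x hx y hy => ?_⟩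
  · have h1 := congrArg Ψ₁ hab
    rwa [← LinearMap.comp_apply, ← LinearMap.comp_apply, hleft] at h1
  · refine (hΦ ⟨x, hx⟩ ⟨y, hy⟩).trans ?_
    rw [cls, dif_pos (hcyc x hx y hy)]
    rfl

end Kunneth

section PivotMatching

variable {V : Type} [LinearOrder V] {good : Finset V → Prop} {k : ℕ}

/-- Contractibility from a sequence of monotone conditions `Ok t`, each depending only on the
part `K t` of a face: at the first failing condition one toggles an element determined by that
part, and faces satisfying all conditions are large. -/
theorem contractibleBelow_of_pivot [Finite V] [Nonempty V]
    (hup : ∀ S T, S ⊆ T → good S → good T) (N : ℕ) (Ok : ℕ → Finset V → Prop)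
    (P : ℕ → V → Prop) (Cut : ℕ → Finset V → V → Prop)
    [∀ t, DecidablePred (P t)]
    (hOk : ∀ t S T, S ⊆ T → Ok t S → Ok t T)
    (hOkP : ∀ t S T, S.filter (P t) = T.filter (P t) → Ok t S → Ok t T)
    (hcrit : ∀ S, good S → (∀ t < N, Ok t S) → k ≤ S.card)
    (hcut : ∀ S t, good S → (∀ u < t, Ok u S) → ¬ Ok t S →
      ∃ v, Cut t (S.filter (P t)) v)
    (htog : ∀ S t v, good S → (∀ u < t, Ok u S) → Cut t (S.filter (P t)) v →
      ¬ P t v ∧ good (S.erase v) ∧ ∀ u < t, Ok u (S.erase v)) :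
    ContractibleBelow good k := by
  classical
  have := Fintype.ofFinite V
  have hex : ∀ S, ∃ t, N ≤ t ∨ ¬ Ok t S := fun S => ⟨N, Or.inl le_rfl⟩
  let piv : Finset V → ℕ := fun S => Nat.find (hex S)
  let K : Finset V → Finset V := fun S => S.filter (P (piv S))
  let B := Fintype.card V + 1
  have hKB : ∀ S, (K S).card < B := fun S => Nat.lt_succ_of_le (card_le_univ _)
  have hpiv_below : ∀ S, ∀ t < piv S, Ok t S := fun S t ht => by
    have := Nat.find_min (hex S) ht
    tauto
  have hpiv_eq : ∀ S t, t < N → (∀ u < t, Ok u S) → ¬ Ok t S → piv S = t := by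
    intro S t ht h1 h2
    refine (Nat.find_eq_iff _).2 ⟨Or.inr h2, fun u hu => ?_⟩
    rintro (h | h)
    · omega
    · exact h (h1 u hu)
  refine contractibleBelow_of_matching (r := fun S => piv S * B + (K S).card)
    (e := fun S => Classical.epsilon (Cut (piv S) (K S))) hup ?_ ?_
  · intro S T _ hST
    have hle : piv S ≤ piv T := by
      refine Nat.find_min' _ ?_
      rcases Nat.find_spec (hex T) with h | h
      · exact Or.inl h
      · exact Or.inr fun h' => h (hOk _ _ _ hST h')
    rcases hle.lt_or_eq with hlt | heq
    · have h1 : piv S * B + (K S).card < piv T * B + (K T).card :=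
        calc piv S * B + (K S).card < piv S * B + B := by have := hKB S; omega
          _ = (piv S + 1) * B := by ring
          _ ≤ piv T * B := Nat.mul_le_mul_right _ hlt
          _ ≤ _ := Nat.le_add_right _ _
      exact ⟨h1.le, fun h => absurd h h1.ne⟩
    · have hK : K S ⊆ K T := by
        simp only [K, heq]
        exact filter_subset_filter _ hST
      rw [heq]
      refine ⟨Nat.add_le_add_left (card_le_card hK) _, fun h => ?_⟩
      rw [eq_of_subset_of_card_le hK (by omega)]
  · intro S hS hcard
    set t := piv S with ht
    have htN : t < N ∧ ¬ Ok t S := by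
      have hlt : t < N := by
        by_contra hN
        exact absurd (hcrit S hS fun u hu => hpiv_below S u (by omega)) (by omega)
      rcases Nat.find_spec (hex S) with h | h
      · exact absurd h (not_le.2 hlt)
      · exact ⟨hlt, h⟩
    set v := Classical.epsilon (Cut t (K S)) with hv
    have hvcut : Cut t (K S) v :=
      Classical.epsilon_spec (hcut S t hS (hpiv_below S) htN.2)
    obtain ⟨hPv, hgood, hbelow⟩ := htog S t v hS (hpiv_below S) hvcut
    have hfe : (S.erase v).filter (P t) = S.filter (P t) := by
      ext u
      simp only [mem_filter, mem_erase]
      constructor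
      · tauto
      · rintro ⟨h1, h2⟩
        exact ⟨⟨fun h => hPv (h ▸ h2), h1⟩, h2⟩
    have hfi : (insert v S).filter (P t) = S.filter (P t) := by
      rw [filter_insert, if_neg hPv]
    have h1 : piv (S.erase v) = t := hpiv_eq _ _ htN.1 hbelow fun h => htN.2 (hOkP _ _ _ hfe h)
    have h2 : piv (insert v S) = t := hpiv_eq _ _ htN.1
      (fun u hu => hOk _ _ _ (subset_insert _ _) (hpiv_below S u hu))
      fun h => htN.2 (hOkP _ _ _ hfi h)
    refine ⟨hgood, ?_⟩
    simp only [K, h1, h2, hfe, hfi]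

end PivotMatching

section TwoConnected

/-- The subgraph of `G` induced on `s` is connected. -/
def Conn {α : Type} (G : SimpleGraph α) (s : Set α) : Prop :=
  s.Nonempty ∧ ∀ U : Set α, (∀ a ∈ s, ∀ b ∈ s, G.Adj a b → a ∈ U → b ∈ U) →
    ∀ x ∈ s, ∀ y ∈ s, x ∈ U → y ∈ U

theorem connected_induce_iff {α : Type} (G : SimpleGraph α) (s : Set α) :
    (G.induce s).Connected ↔ Conn G s := by
  constructor
  · intro h
    obtain ⟨z⟩ := h.nonempty
    refine ⟨⟨z.1, z.2⟩, fun U hU x hx y hy hxU => ?_⟩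
    obtain ⟨p⟩ := h.preconnected ⟨x, hx⟩ ⟨y, hy⟩
    have key : ∀ {u v : s}, (G.induce s).Walk u v → u.1 ∈ U → v.1 ∈ U := by
      intro u v p
      induction p with
      | nil => exact id
      | cons hadj _ ih => exact fun hu => ih (hU _ (Subtype.prop _) _ (Subtype.prop _) hadj hu)
    exact key p hxU
  · rintro ⟨⟨z, hz⟩, h⟩
    refine { preconnected := ?_, nonempty := ⟨⟨z, hz⟩⟩ }
    rintro ⟨x, hx⟩ ⟨y, hy⟩
    obtain ⟨_, hxy⟩ := h {u | ∃ hu : u ∈ s, (G.induce s).Reachable ⟨x, hx⟩ ⟨u, hu⟩}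
      (fun a ha b hb hab ⟨_, hau⟩ => ⟨hb, hau.trans (SimpleGraph.Adj.reachable
        (G := G.induce s) (u := ⟨a, ha⟩) (v := ⟨b, hb⟩) hab)⟩)
      x hx y hy ⟨hx, SimpleGraph.Reachable.refl _⟩
    exact hxy

theorem connected_iff_conn_univ {α : Type} (G : SimpleGraph α) :
    G.Connected ↔ Conn G Set.univ := by
  rw [← connected_induce_iff, (SimpleGraph.induceUnivIso G).connected_iff]

theorem Conn.mono {α : Type} {G G' : SimpleGraph α} {s : Set α} (h : Conn G s)
    (hadj : ∀ a ∈ s, ∀ b ∈ s, G.Adj a b → G'.Adj a b) : Conn G' s :=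
  ⟨h.1, fun U hU => h.2 U fun a ha b hb hab => hU a ha b hb (hadj a ha b hb hab)⟩

theorem Conn.insert {α : Type} {G : SimpleGraph α} {s : Set α} (h : Conn G s) {i x : α}
    (hx : x ∈ s) (hix : G.Adj i x) : Conn G (insert i s) := by
  refine ⟨⟨i, Set.mem_insert _ _⟩, fun U hU => ?_⟩
  have hs := h.2 U fun a ha b hb => hU a (Or.inr ha) b (Or.inr hb)
  have hi : i ∈ U ↔ x ∈ U :=
    ⟨hU i (Or.inl rfl) x (Or.inr hx) hix, hU x (Or.inr hx) i (Or.inl rfl) hix.symm⟩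
  rintro a (rfl | ha) b (rfl | hb) haU
  · exact haU
  · exact hs x hx b hb (hi.1 haU)
  · exact hi.2 (hs a ha x hx haU)
  · exact hs a ha b hb haU

variable {n : ℕ} {G G' : SimpleGraph (Fin n)}

/-- The subgraph of `G` induced on the first `k` nodes is 2-connected. -/
def TwoConn (G : SimpleGraph (Fin n)) (k : ℕ) : Prop :=
  Conn G {u | u.val < k} ∧ ∀ v : Fin n, v.val < k → Conn G {u | u.val < k ∧ u ≠ v}

theorem TwoConn.mono {k : ℕ} (h : TwoConn G k)
    (hadj : ∀ a b : Fin n, a.val < k → b.val < k → G.Adj a b → G'.Adj a b) : TwoConn G' k :=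
  ⟨h.1.mono fun a ha b hb => hadj a b ha hb,
    fun v hv => (h.2 v hv).mono fun a ha b hb => hadj a b ha.1 hb.1⟩

theorem TwoConn.conn_lt {i : Fin n} (h : TwoConn G (i.val + 1)) : Conn G {u | u.val < i.val} := by
  convert h.2 i (Nat.lt_succ_self _) using 1
  ext u
  simp only [Set.mem_ofPred_eq, ne_eq, Fin.ext_iff]
  omega

theorem exists_lt_ne {i : Fin n} (hi : 2 ≤ i.val) (v : Fin n) : ∃ u : Fin n, u < i ∧ u ≠ v := by
  have hn := i.2
  by_cases hv : v.val = 0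
  · exact ⟨⟨1, by omega⟩, Fin.lt_def.2 (by simp; omega), fun h => by simp [← h] at hv⟩
  · exact ⟨⟨0, by omega⟩, Fin.lt_def.2 (by simp; omega), fun h => by simp [← h] at hv⟩

/-- The last node of a 2-connected graph has a neighbour other than any given node. -/
theorem TwoConn.exists_adj_ne {i : Fin n} (h : TwoConn G (i.val + 1)) (hi : 2 ≤ i.val)
    (v : Fin n) : ∃ x : Fin n, x < i ∧ x ≠ v ∧ G.Adj i x := by
  have key : ∀ v : Fin n, v < i → ∃ x : Fin n, x < i ∧ x ≠ v ∧ G.Adj i x := by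
    intro v hv
    by_contra! hcon
    obtain ⟨u, hu, huv⟩ := exists_lt_ne hi v
    refine hu.ne ((h.2 v (by omega)).2 {i} ?_ i ⟨by simp, hv.ne'⟩ u
      ⟨by simp; omega, huv⟩ rfl)
    rintro a - b ⟨hb, hbv⟩ hab rfl
    have hne : a ≠ b := hab.ne
    exact absurd hab (hcon b (by simp at hb; omega) hbv)
  by_cases hv : v < i
  · exact key v hv
  · obtain ⟨u, hu, -⟩ := exists_lt_ne hi v
    obtain ⟨x, hx, -, hadj⟩ := key u hu
    exact ⟨x, hx, fun h => hv (h ▸ hx), hadj⟩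

theorem TwoConn.succ {i : Fin n} (h' : TwoConn G' i.val) (h : TwoConn G (i.val + 1))
    (hi : 2 ≤ i.val) (hadj : ∀ x, G.Adj i x → G'.Adj i x) : TwoConn G' (i.val + 1) := by
  constructor
  · obtain ⟨x, hx, -, hix⟩ := h.exists_adj_ne hi i
    convert h'.1.insert hx (hadj x hix) using 1
    ext u
    simp only [Set.mem_ofPred_eq, Set.mem_insert_iff, Fin.ext_iff]
    omega
  · intro v hv
    by_cases hvi : v = i
    · subst hvi
      convert h'.1 using 1
      ext u
      simp only [Set.mem_ofPred_eq, ne_eq, Fin.ext_iff]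
      omega
    · obtain ⟨x, hx, hxv, hix⟩ := h.exists_adj_ne hi v
      have hvi' : v.val ≠ i.val := fun e => hvi (Fin.ext e)
      convert (h'.2 v (by omega)).insert (i := i) ⟨hx, hxv⟩ (hadj x hix) using 1
      ext u
      simp only [Set.mem_ofPred_eq, Set.mem_insert_iff, ne_eq, Fin.ext_iff]
      omega

/-- If `w` is a cut point of the graph on the nodes before `i`, then removing the edge joining
`i` and `w` preserves 2-connectedness of the graph on the nodes up to `i`. -/
theorem TwoConn.remove_edge {i w : Fin n} (h : TwoConn G (i.val + 1)) (hi : 2 ≤ i.val)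
    (hwi : w < i) (hcut : ¬ Conn G {u | u.val < i.val ∧ u ≠ w})
    (hadj : ∀ a b, G.Adj a b → G'.Adj a b ∨ (a = i ∧ b = w) ∨ (a = w ∧ b = i)) :
    TwoConn G' (i.val + 1) := by
  obtain ⟨z, hz⟩ := exists_lt_ne hi w
  have hlt := h.conn_lt
  -- `T` is a union of components of the graph without `w` that avoids the removed node `v`
  have key : ∀ (s T U : Set (Fin n)) (v : Fin n), (∀ u : Fin n, u ≤ i → u ≠ v → u ∈ s) →
      (∀ u ∈ T, u < i ∧ u ≠ w) → v ∉ T → T.Nonempty →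
      (∀ a ∈ T, ∀ b, b < i → b ≠ w → G.Adj a b → b ∈ T) →
      (∀ a ∈ s, ∀ b ∈ s, G'.Adj a b → a ∈ U → b ∈ U) →
      i ∈ s → w ∈ s → i ∈ U → w ∈ U := by
    intro s T U v hs hT hvT ⟨t, ht⟩ hTcl hU his hws hiU
    have hTs : ∀ u ∈ T, u ∈ s := fun u hu => hs u (hT u hu).1.le fun e => hvT (e ▸ hu)
    by_contra hwU
    have hx : ∃ x ∈ T, G.Adj i x := by
      by_contra! hcon
      refine (hT i ((h.2 w (by omega)).2 T ?_ t ⟨?_, (hT t ht).2⟩ i ⟨by simp, hwi.ne'⟩ ht)).1.ne rfl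
      · rintro a - b ⟨hb, hbw⟩ hab haT
        rcases (Fin.le_def.2 (Nat.lt_succ_iff.1 hb)).lt_or_eq with hbi | rfl
        · exact hTcl a haT b hbi hbw hab
        · exact absurd hab.symm (hcon a haT)
      · have := (hT t ht).1
        simp
        omega
    obtain ⟨x, hxT, hix⟩ := hx
    have hxU : x ∈ U := by
      refine hU i his x (hTs x hxT) ?_ hiU
      rcases hadj i x hix with h | h | h
      · exact h
      · exact absurd h.2 (hT x hxT).2
      · exact absurd h.1 hwi.ne'
    have hfin := hlt.2 (U ∩ T) ?_ x (hT x hxT).1 w hwi ⟨hxU, hxT⟩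
    · exact hwU hfin.1
    · rintro a - b hb hab ⟨haU, haT⟩
      have hab' : G'.Adj a b := by
        rcases hadj a b hab with h | h | h
        · exact h
        · exact absurd h.1 (hT a haT).1.ne
        · exact absurd h.1 (hT a haT).2
      by_cases hbw : b = w
      · subst hbw
        exact absurd (hU a (hTs a haT) b hws hab' haU) hwU
      · have hbT := hTcl a haT b hb hbw hab
        exact ⟨hU a (hTs a haT) b (hTs b hbT) hab' haU, hbT⟩
  have main : ∀ (s : Set (Fin n)) (v : Fin n), (∀ u : Fin n, u ≤ i → u ≠ v → u ∈ s) →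
      Conn G s → Conn G' s := by
    intro s v hs hGs
    have hstep : ∀ U : Set (Fin n), (∀ a ∈ s, ∀ b ∈ s, G'.Adj a b → a ∈ U → b ∈ U) →
        i ∈ s → w ∈ s → i ∈ U → w ∈ U := by
      intro U hU his hws hiU
      have hcut' : ∃ U₀ : Set (Fin n), (∀ a, a < i → a ≠ w → ∀ b, b < i → b ≠ w → G.Adj a b →
          a ∈ U₀ → b ∈ U₀) ∧ (∃ x, x < i ∧ x ≠ w ∧ x ∈ U₀) ∧ ∃ y, y < i ∧ y ≠ w ∧ y ∉ U₀ := by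
        by_contra! hcon
        refine hcut ⟨⟨z, hz⟩, fun U₀ hU₀ x hx y hy hxU => hcon U₀ ?_ ⟨x, hx.1, hx.2, hxU⟩ y hy.1 hy.2⟩
        exact fun a h1 h2 b h3 h4 => hU₀ a ⟨h1, h2⟩ b ⟨h3, h4⟩
      obtain ⟨U₀, hcl, ⟨x, hxi, hxw, hxU⟩, y, hyi, hyw, hyU⟩ := hcut'
      by_cases hv : v ∈ U₀
      · refine key s {u | u < i ∧ u ≠ w ∧ u ∉ U₀} U v hs (fun u hu => ⟨hu.1, hu.2.1⟩)
          (fun h => h.2.2 hv) ⟨y, hyi, hyw, hyU⟩ ?_ hU his hws hiU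
        exact fun a ha b hbi hbw hab => ⟨hbi, hbw, fun hb => ha.2.2
          (hcl b hbi hbw a ha.1 ha.2.1 hab.symm hb)⟩
      · refine key s {u | u < i ∧ u ≠ w ∧ u ∈ U₀} U v hs (fun u hu => ⟨hu.1, hu.2.1⟩)
          (fun h => hv h.2.2) ⟨x, hxi, hxw, hxU⟩ ?_ hU his hws hiU
        exact fun a ha b hbi hbw hab => ⟨hbi, hbw, hcl a ha.1 ha.2.1 b hbi hbw hab ha.2.2⟩
    refine ⟨hGs.1, fun U hU => hGs.2 U fun a ha b hb hab haU => ?_⟩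
    rcases hadj a b hab with h | ⟨rfl, rfl⟩ | ⟨rfl, rfl⟩
    · exact hU a ha b hb h haU
    · exact hstep U hU ha hb haU
    · by_contra hbU
      exact hstep Uᶜ (fun c hc d hd hcd hcU hdU => hcU (hU d hd c hc hcd.symm hdU)) hb ha hbU haU
  refine ⟨main _ i (fun u hu _ => Nat.lt_succ_of_le hu) h.1, fun v hv => main _ v ?_ (h.2 v hv)⟩
  exact fun u hu huv => ⟨Nat.lt_succ_of_le hu, huv⟩

end TwoConnected

section Collections

variable {m : ℕ} {A : Fin m → ℕ}

theorem adj_grOf_iff {S : Finset (VtxE m A)} {j : Fin m} {a b : Fin (A j)} (h : a < b) :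
    (grOf m A S j).Adj a b ↔ (⟨j, ⟨(a, b), h⟩⟩ : VtxE m A) ∈ S := by
  rw [grOf, SimpleGraph.fromEdgeSet_adj]
  constructor
  · rintro ⟨⟨⟨⟨c, d⟩, hcd⟩, he, hq⟩, -⟩
    rcases Sym2.eq_iff.1 hq with ⟨h1, h2⟩ | ⟨h1, h2⟩
    · subst h1 h2
      exact he
    · subst h1 h2
      exact absurd hcd h.not_gt
  · exact fun he => ⟨⟨_, he, rfl⟩, h.ne⟩

/-- Adjacency passes from `S` to `T` if every edge of `S` joining the two nodes lies in `T`. -/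
theorem adj_grOf_of_forall {S T : Finset (VtxE m A)} {j : Fin m} {a b : Fin (A j)}
    (hab : (grOf m A S j).Adj a b)
    (h : ∀ e : Edge (A j), (⟨j, e⟩ : VtxE m A) ∈ S → (e.1 = (a, b) ∨ e.1 = (b, a)) →
      (⟨j, e⟩ : VtxE m A) ∈ T) : (grOf m A T j).Adj a b := by
  rcases hab.ne.lt_or_gt with hlt | hlt
  · exact (adj_grOf_iff hlt).2 (h _ ((adj_grOf_iff hlt).1 hab) (Or.inl rfl))
  · exact ((adj_grOf_iff hlt).2 (h _ ((adj_grOf_iff hlt).1 hab.symm) (Or.inr rfl))).symm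

theorem TwoConn.grOf_mono {S T : Finset (VtxE m A)} (hST : S ⊆ T) {j : Fin m} {k : ℕ}
    (h : TwoConn (grOf m A S j) k) : TwoConn (grOf m A T j) k :=
  h.mono fun _ _ _ _ hab => adj_grOf_of_forall hab fun _ he _ => hST he

theorem goodTwoConn_iff (S : Finset (VtxE m A)) :
    goodTwoConn m A S ↔ ∀ j, TwoConn (grOf m A S j) (A j) := by
  refine forall_congr' fun j => ?_
  have h1 : {u : Fin (A j) | u.val < A j} = Set.univ := Set.eq_univ_of_forall fun u => u.2
  have h2 : ∀ v : Fin (A j), {u : Fin (A j) | u.val < A j ∧ u ≠ v} = {u | u ≠ v} := fun v => by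
    ext u
    simp
  simp_rw [TwoConn, h1, h2, connected_induce_iff, connected_iff_conn_univ]
  exact and_congr Iff.rfl ⟨fun h v _ => h v, fun h v => h v v.2⟩

theorem goodTwoConn_mono (S T : Finset (VtxE m A)) (hST : S ⊆ T) (hS : goodTwoConn m A S) :
    goodTwoConn m A T :=
  (goodTwoConn_iff T).2 fun j => ((goodTwoConn_iff S).1 hS j).grOf_mono hST

/-- A graph which is 2-connected on the first two nodes has the edge joining them. -/
theorem TwoConn.adj_zero_one {n : ℕ} {G : SimpleGraph (Fin n)} (h : TwoConn G 2) (hn : 2 ≤ n) :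
    G.Adj ⟨0, by omega⟩ ⟨1, by omega⟩ := by
  by_contra hcon
  have h1 := h.1.2 {⟨0, by omega⟩} ?_ ⟨0, by omega⟩ (by simp) ⟨1, by omega⟩ (by simp) rfl
  · simp at h1
  · rintro a - b hb hab rfl
    have hb1 : b = ⟨1, by omega⟩ := by
      have h2 := hab.ne
      simp only [ne_eq, Fin.ext_iff] at h2
      simp only [Set.mem_ofPred_eq] at hb
      exact Fin.ext (by simp; omega)
    exact absurd (hb1 ▸ hab) hcon

theorem not_goodTwoConn_empty (hm : 1 ≤ m) (hA : ∀ j, 2 ≤ A j) : ¬ goodTwoConn m A ∅ := by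
  intro h
  have hconn := (h ⟨0, hm⟩).1
  rw [connected_iff_conn_univ] at hconn
  have hA0 := hA ⟨0, hm⟩
  have h1 := hconn.2 {⟨0, by omega⟩} ?_ ⟨0, by omega⟩ (by simp) ⟨1, by omega⟩ (by simp) rfl
  · simp at h1
  · intro a _ b _ hab
    simp [grOf] at hab

/-- Removing an edge that ends at `i` and begins at a cut point of the preceding nodes preserves
2-connectedness of the graphs on the first `l` nodes for `l > i`. -/
theorem TwoConn.of_forall_mem {S T : Finset (VtxE m A)} {j : Fin m} {i w : Fin (A j)}
    (hwi : w < i) (hT : ∀ v ∈ S, v ≠ ⟨j, ⟨(w, i), hwi⟩⟩ → v ∈ T) (hi : 2 ≤ i.val) (hcut : ¬ Conn (grOf m A S j) {u | u.val < i.val ∧ u ≠ w})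
    {l : ℕ} (hil : i.val < l) (hl : l ≤ A j)
    (h : ∀ l', i.val < l' → l' ≤ l → TwoConn (grOf m A S j) l') :
    TwoConn (grOf m A T j) l := by
  have hadj : ∀ a b, (grOf m A S j).Adj a b →
      (grOf m A T j).Adj a b ∨ (a = i ∧ b = w) ∨ (a = w ∧ b = i) := by
    intro a b hab
    by_cases hwi' : (a = i ∧ b = w) ∨ (a = w ∧ b = i)
    · exact Or.inr hwi'
    · refine Or.inl (adj_grOf_of_forall hab fun e he hor => hT _ he ?_)
      rintro heq
      obtain rfl : e = ⟨(w, i), hwi⟩ := by simpa using heq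
      simp only [Prod.mk.injEq] at hor
      tauto
  induction l, hil using Nat.le_induction with
  | base => exact (h _ (Nat.lt_succ_self _) le_rfl).remove_edge hi hwi hcut hadj
  | succ l hil ih =>
    have ih' := ih (by omega) fun l' h1 h2 => h l' h1 (by omega)
    refine TwoConn.succ (i := ⟨l, by omega⟩) ih' (h (l + 1) (by omega) le_rfl) (by simp; omega) ?_
    intro x hx
    rcases hadj _ _ hx with h | h | h
    · exact h
    · exact absurd (congrArg Fin.val h.1) (by simp; omega)
    · have := congrArg Fin.val h.1
      have := Fin.lt_def.1 hwi
      simp at *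
      omega

theorem TwoConn.of_forall_mem_of_ne {S T : Finset (VtxE m A)} {j : Fin m} {v : VtxE m A}
    (hT : ∀ u ∈ S, u ≠ v → u ∈ T) (hj : v.1 ≠ j) {k : ℕ} (h : TwoConn (grOf m A S j) k) :
    TwoConn (grOf m A T j) k :=
  h.mono fun _ _ _ _ hab => adj_grOf_of_forall hab fun _ he _ =>
    hT _ he fun heq => hj (heq ▸ rfl)

/-- A collection of graphs all of whose initial segments are 2-connected has many edges. -/
theorem card_ge_of_forall_twoConn (hA : ∀ j, 2 ≤ A j) {S : Finset (VtxE m A)}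
    (h : ∀ j k, 2 ≤ k → k ≤ A j → TwoConn (grOf m A S j) k) :
    ∑ j, (2 * A j - 3) ≤ S.card := by
  classical
  have hcount : ∀ n, 2 ≤ n → ∑ b : Fin n, min b.val 2 = 2 * n - 3 := by
    intro n hn
    rw [Fin.sum_univ_eq_sum_range (fun b => min b 2)]
    induction n, hn using Nat.le_induction with
    | base => rfl
    | succ n hn ih => rw [sum_range_succ, ih]; omega
  have hcard : S.card = ∑ x : (Σ j : Fin m, Fin (A j)),
      (S.filter fun v => (⟨v.1, v.2.1.2⟩ : Σ j : Fin m, Fin (A j)) = x).card :=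
    card_eq_sum_card_fiberwise fun _ _ => mem_univ _
  rw [hcard, Fintype.sum_sigma]
  refine sum_le_sum fun j _ => ?_
  rw [← hcount (A j) (hA j)]
  refine sum_le_sum fun b _ => ?_
  have hmem : ∀ (x : Fin (A j)) (hxb : x < b), (grOf m A S j).Adj x b →
      (⟨j, ⟨(x, b), hxb⟩⟩ : VtxE m A) ∈
        S.filter fun v => (⟨v.1, v.2.1.2⟩ : Σ j : Fin m, Fin (A j)) = ⟨j, b⟩ :=
    fun x hxb hadj => mem_filter.2 ⟨(adj_grOf_iff hxb).1 hadj, rfl⟩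
  have hb := b.2
  rcases Nat.lt_or_ge b.val 2 with hb2 | hb2
  · rcases Nat.eq_zero_or_pos b.val with hb0 | hb0
    · simp [hb0]
    · have hb1 : b = ⟨1, by omega⟩ := Fin.ext (by simp; omega)
      have hadj := (h j 2 le_rfl (hA j)).adj_zero_one (hA j)
      rw [← hb1] at hadj
      have := card_pos.2 ⟨_, hmem _ (Fin.lt_def.2 (by simpa using hb0)) hadj⟩
      omega
  · have hT := h j (b.val + 1) (by omega) (by omega)
    obtain ⟨x, hxb, -, hx⟩ := hT.exists_adj_ne hb2 b
    obtain ⟨y, hyb, hyx, hy⟩ := hT.exists_adj_ne hb2 x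
    have := one_lt_card.2 ⟨_, hmem x hxb hx.symm, _, hmem y hyb hy.symm, fun heq => hyx ?_⟩
    · omega
    · simp only [Sigma.mk.injEq, heq_eq_eq, true_and, Subtype.mk.injEq, Prod.mk.injEq,
        and_true] at heq
      exact heq.symm

theorem sum_eq_topDeg_add_one (hm : 1 ≤ m) (hA : ∀ j, 2 ≤ A j) :
    ∑ j, (2 * A j - 3) = topDeg m A + 1 := by
  have h1 : ∑ j, (2 * A j - 3) + 3 * m = 2 * ∑ j, A j := by
    rw [mul_sum, ← sum_congr rfl fun j _ => Nat.sub_add_cancel (show 3 ≤ 2 * A j by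
      have := hA j; omega), sum_add_distrib]
    simp [mul_comm]
  have h2 : ∑ _j : Fin m, 1 ≤ ∑ j, (2 * A j - 3) := sum_le_sum fun j _ => by
    have := hA j
    omega
  simp at h2
  rw [topDeg]
  omega

/-- The position of a pair `(j, i)` in the order by increasing `j` and decreasing `i < M`
determines the pair. -/
theorem encode_inj {M j j' i i' : ℕ} (hi : 0 < i) (hiM : i < M) (hi' : 0 < i') (hiM' : i' < M)
    (h : j * M + (M - i) = j' * M + (M - i')) : j = j' ∧ i = i' := by
  have h1 : j = j' := by
    have e : (j * M + (M - i)) / M = j := by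
      rw [mul_comm, Nat.mul_add_div (by omega), Nat.div_eq_of_lt (by omega), add_zero]
    have e' : (j' * M + (M - i')) / M = j' := by
      rw [mul_comm, Nat.mul_add_div (by omega), Nat.div_eq_of_lt (by omega), add_zero]
    rw [← e, h, e']
  subst h1
  omega

/-- The quotient complex of collections of 2-connected graphs is contractible below its top
homology degree. One toggles the edge from a chosen cut point to the node following the largest
initial segment, among the first affected graph, that is not 2-connected. -/
theorem contractibleBelow_goodTwoConn (hm : 1 ≤ m) (hA : ∀ j, 2 ≤ A j)
    [LinearOrder (VtxE m A)] : ContractibleBelow (goodTwoConn m A) (topDeg m A + 1) := by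
  classical
  let M := ∑ j, A j + 1
  have hM : ∀ j, A j < M := fun j =>
    Nat.lt_succ_of_le (single_le_sum (fun _ _ => Nat.zero_le _) (mem_univ j))
  have : Nonempty (VtxE m A) := ⟨⟨⟨0, hm⟩, ⟨(⟨0, by have := hA ⟨0, hm⟩; omega⟩,
    ⟨1, by have := hA ⟨0, hm⟩; omega⟩), by simp⟩⟩⟩
  let Pos : ℕ → Fin m → ℕ → Prop := fun t j i => 2 ≤ i ∧ i ≤ A j ∧ t = j.val * M + (M - i)
  have hpos : ∀ {t j i j' i'}, Pos t j i → Pos t j' i' → j = j' ∧ i = i' := by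
    rintro t j i j' i' ⟨h1, h2, h3⟩ ⟨h1', h2', h3'⟩
    have := hM j
    have := hM j'
    have := encode_inj (by omega) (by omega) (by omega) (by omega) (h3.symm.trans h3')
    exact ⟨Fin.ext this.1, this.2⟩
  let Ok : ℕ → Finset (VtxE m A) → Prop := fun t S =>
    ∀ j i, Pos t j i → TwoConn (grOf m A S j) i
  let P : ℕ → VtxE m A → Prop := fun t v => ∃ i, Pos t v.1 i ∧ v.2.1.2.val < i
  let Cut : ℕ → Finset (VtxE m A) → VtxE m A → Prop := fun t K v =>
    Pos t v.1 v.2.1.2.val ∧ ¬ Conn (grOf m A K v.1) {u | u.val < v.2.1.2.val ∧ u ≠ v.2.1.1}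
  have hfilter : ∀ {t j i} {S : Finset (VtxE m A)} {a b : Fin (A j)}, Pos t j i → a.val < i →
      b.val < i → (grOf m A S j).Adj a b → (grOf m A (S.filter (P t)) j).Adj a b := by
    intro t j i S a b hp ha hb hab
    refine adj_grOf_of_forall hab fun e he hor => mem_filter.2 ⟨he, i, hp, ?_⟩
    rcases hor with h | h <;> simpa [h]
  have hlast : ∀ {t j i} {S : Finset (VtxE m A)}, (∀ u < t, Ok u S) → Pos t j i →
      ∀ l, i < l → l ≤ A j → TwoConn (grOf m A S j) l := by
    rintro t j i S hbelow ⟨h1, h2, h3⟩ l hl hlA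
    have := hM j
    exact hbelow (j.val * M + (M - l)) (by omega) j l ⟨by omega, hlA, rfl⟩
  refine contractibleBelow_of_pivot goodTwoConn_mono (m * M) Ok P Cut ?_ ?_ ?_ ?_ ?_
  · exact fun t S T hST h j i hp => (h j i hp).grOf_mono hST
  · intro t S T hST h j i hp
    have h1 : TwoConn (grOf m A (S.filter (P t)) j) i :=
      (h j i hp).mono fun a b ha hb => hfilter hp ha hb
    rw [hST] at h1
    exact h1.grOf_mono (filter_subset _ _)
  · intro S _ h
    rw [← sum_eq_topDeg_add_one hm hA]
    refine card_ge_of_forall_twoConn hA fun j i hi hiA => h _ ?_ j i ⟨hi, hiA, rfl⟩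
    have := hM j
    calc j.val * M + (M - i) < j.val * M + M := by omega
      _ = (j.val + 1) * M := by ring
      _ ≤ m * M := Nat.mul_le_mul_right _ j.2
  · intro S t hS hbelow hOk
    simp only [Ok, not_forall] at hOk
    obtain ⟨j, i, hp, hnot⟩ := hOk
    have hiA : i < A j := lt_of_le_of_ne hp.2.1 fun heq =>
      hnot (heq ▸ (goodTwoConn_iff S).1 hS j)
    have hlt := (hlast hbelow hp (i + 1) (by omega) hiA).conn_lt (i := ⟨i, hiA⟩)
    have hw : ∃ w : Fin (A j), w.val < i ∧
        ¬ Conn (grOf m A S j) {u | u.val < i ∧ u ≠ w} := by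
      by_contra! hcon
      exact hnot ⟨hlt, hcon⟩
    obtain ⟨w, hwi, hw⟩ := hw
    refine ⟨⟨j, ⟨(w, ⟨i, hiA⟩), hwi⟩⟩, hp, fun hcon => hw (hcon.mono fun a _ b _ hab => ?_)⟩
    exact adj_grOf_of_forall hab fun e he _ => (mem_filter.1 he).1
  · rintro S t ⟨j, ⟨⟨w, i⟩, hwi⟩⟩ hS hbelow ⟨hp, hcut⟩
    have hp' : Pos t j i.val := hp
    have hcut' : ¬ Conn (grOf m A S j) {u | u.val < i.val ∧ u ≠ w} := fun hcon =>
      hcut (hcon.mono fun a ha b hb => hfilter hp' ha.1 hb.1)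
    suffices key : ∀ T, (∀ v ∈ S, v ≠ ⟨j, ⟨(w, i), hwi⟩⟩ → v ∈ T) →
        goodTwoConn m A T ∧ ∀ u < t, Ok u T by
      refine ⟨?_, key _ fun v hv hne => (@mem_erase _ (_) _ _ _).2 ⟨hne, hv⟩⟩
      rintro ⟨i', hi', hlt⟩
      rw [← (hpos hp' hi').2] at hlt
      exact lt_irrefl _ hlt
    intro T hT
    have herase : ∀ l, i.val < l → l ≤ A j → TwoConn (grOf m A T j) l := fun l hil hl =>
      TwoConn.of_forall_mem hwi hT hp.1 hcut' hil hl fun l' h1 h2 =>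
        hlast hbelow hp' l' h1 (by omega)
    constructor
    · refine (goodTwoConn_iff _).2 fun j' => ?_
      by_cases hj : j = j'
      · subst hj
        exact herase _ i.2 le_rfl
      · exact TwoConn.of_forall_mem_of_ne hT hj ((goodTwoConn_iff S).1 hS j')
    · intro u hu j' i' hp''
      by_cases hj : j = j'
      · subst hj
        refine herase i' ?_ hp''.2.1
        have h1 := hp''.2.2
        have h2 := hp'.2.2
        omega
      · exact TwoConn.of_forall_mem_of_ne hT hj (hbelow u hu j' i' hp'')

end Collections

section JoinCollections

variable {m' m'' : ℕ} {A' : Fin m' → ℕ} {A'' : Fin m'' → ℕ}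

theorem goodCat_disjSum (S : Finset (VtxE m' A')) (T : Finset (VtxE m'' A'')) :
    goodCat m' m'' A' A'' (S.disjSum T) ↔ goodTwoConn m' A' S ∧ goodTwoConn m'' A'' T := by
  have h1 : (S.disjSum T).preimage Sum.inl Sum.inl_injective.injOn = S := by
    ext
    simp
  have h2 : (S.disjSum T).preimage Sum.inr Sum.inr_injective.injOn = T := by
    ext
    simp
  rw [goodCat, h1, h2]

theorem incl_join {p q : ℕ} (x : Chain (VtxE m' A') p) (y : Chain (VtxE m'' A'') q) :
    incl (join m' m'' A' A'' p q x y) = joinChain (incl x) (incl y) := by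
  suffices h : (join m' m'' A' A'' p q).compr₂ incl = joinChain.compl₁₂ incl incl from
    LinearMap.congr_fun₂ h x y
  refine chain_ext fun S => chain_ext fun T => ?_
  have hunion : (joinGen m' m'' A' A'' p q S T).1 = S.1.disjSum T.1 := by
    ext u
    rcases u with u | u <;> simp [joinGen]
  simp [join, incl_single, joinChain_single, hunion]

end JoinCollections

end FaceComplex

open FaceComplex

/-- With `p = 2|A'| − 3m' − 1` and `q = 2|A''| − 3m'' − 1`,
the bilinear join map carries cycles of degrees `p` and `q` of `Q'` and `Q''`
to cycles of degree `p + q + 1` of `Q`, carries boundaries to boundaries, and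
the induced homomorphism `H_p(Q') ⊗ H_q(Q'') → H_{p+q+1}(Q)` is an isomorphism
of abelian groups. -/
theorem join_homology_iso (m' m'' : ℕ) (A' : Fin m' → ℕ) (A'' : Fin m'' → ℕ)
    (hm' : 1 ≤ m') (hm'' : 1 ≤ m'') (hA' : ∀ j, 2 ≤ A' j) (hA'' : ∀ j, 2 ≤ A'' j)
    [LinearOrder (VtxE m' A')] [LinearOrder (VtxE m'' A'')] :
    (∀ x ∈ cycles (VtxE m' A') (goodTwoConn m' A') (topDeg m' A'),
      ∀ y ∈ cycles (VtxE m'' A'') (goodTwoConn m'' A'') (topDeg m'' A''),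
        join m' m'' A' A'' (topDeg m' A') (topDeg m'' A'') x y ∈
          cycles (VtxE m' A' ⊕ VtxE m'' A'') (goodCat m' m'' A' A'')
            (topDeg m' A' + topDeg m'' A'' + 1)) ∧
    (∀ x ∈ badChains (VtxE m' A') (goodTwoConn m' A') (topDeg m' A') ⊔
        LinearMap.range (bdry (VtxE m' A') (topDeg m' A' + 1)),
      ∀ y ∈ cycles (VtxE m'' A'') (goodTwoConn m'' A'') (topDeg m'' A''),
        join m' m'' A' A'' (topDeg m' A') (topDeg m'' A'') x y ∈
          badChains (VtxE m' A' ⊕ VtxE m'' A'') (goodCat m' m'' A' A'')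
            (topDeg m' A' + topDeg m'' A'' + 1) ⊔
          LinearMap.range (bdry (VtxE m' A' ⊕ VtxE m'' A'')
            (topDeg m' A' + topDeg m'' A'' + 2))) ∧
    (∀ x ∈ cycles (VtxE m' A') (goodTwoConn m' A') (topDeg m' A'),
      ∀ y ∈ badChains (VtxE m'' A'') (goodTwoConn m'' A'') (topDeg m'' A'') ⊔
        LinearMap.range (bdry (VtxE m'' A'') (topDeg m'' A'' + 1)),
        join m' m'' A' A'' (topDeg m' A') (topDeg m'' A'') x y ∈
          badChains (VtxE m' A' ⊕ VtxE m'' A'') (goodCat m' m'' A' A'')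
            (topDeg m' A' + topDeg m'' A'' + 1) ⊔
          LinearMap.range (bdry (VtxE m' A' ⊕ VtxE m'' A'')
            (topDeg m' A' + topDeg m'' A'' + 2))) ∧
    ∃ Φ : (homology (VtxE m' A') (goodTwoConn m' A') (topDeg m' A')) ⊗[ℤ]
        (homology (VtxE m'' A'') (goodTwoConn m'' A'') (topDeg m'' A'')) ≃ₗ[ℤ]
        homology (VtxE m' A' ⊕ VtxE m'' A'') (goodCat m' m'' A' A'')
          (topDeg m' A' + topDeg m'' A'' + 1),
      ∀ (x : Chain (VtxE m' A') (topDeg m' A'))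
        (hx : x ∈ cycles (VtxE m' A') (goodTwoConn m' A') (topDeg m' A'))
        (y : Chain (VtxE m'' A'') (topDeg m'' A''))
        (hy : y ∈ cycles (VtxE m'' A'') (goodTwoConn m'' A'') (topDeg m'' A'')),
        Φ (Submodule.Quotient.mk ⟨x, hx⟩ ⊗ₜ[ℤ] Submodule.Quotient.mk ⟨y, hy⟩) =
          cls (VtxE m' A' ⊕ VtxE m'' A'') (goodCat m' m'' A' A'')
            (topDeg m' A' + topDeg m'' A'' + 1)
            (join m' m'' A' A'' (topDeg m' A') (topDeg m'' A'') x y) := by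
  have hg := goodCat_disjSum (A' := A') (A'' := A'')
  have hup' := goodTwoConn_mono (A := A')
  have hup'' := goodTwoConn_mono (A := A'')
  have hempty' := not_goodTwoConn_empty hm' hA'
  have hempty'' := not_goodTwoConn_empty hm'' hA''
  have hempty : ¬ goodCat m' m'' A' A'' ∅ := fun h => hempty' ((hg ∅ ∅).1 h).1
  have hJ := incl_join (A' := A') (A'' := A'') (p := topDeg m' A') (q := topDeg m'' A'')
  exact ⟨fun x hx y hy => join_mem_cycles hg hempty' hempty'' hempty hJ hx hy,
    fun x hx y hy => join_mem_boundaries_left hg hempty' hempty'' hempty hJ hx hy,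
    fun x hx y hy => join_mem_boundaries_right hg hempty' hempty'' hempty hJ hx hy,
    exists_kunneth_equiv hg hup' hup'' hempty' hempty'' hempty hJ
      (contractibleBelow_goodTwoConn hm' hA') (contractibleBelow_goodTwoConn hm'' hA'')⟩

end
end

section
/- Let Υ be an A-set all of whose groups consist of pairwise distinct points, and let Ῡ be a completion of Υ with Ῡ ≠ Υ. Then there exists a group Ḡ of Ῡ such that the graph whose node set is Ḡ and whose edges are the unordered pairs of distinct points of Ḡ contained in a common group of Υ is not 2-connected. -/
set_option autoImplicit false

/-!
Statement 9: If Ῡ ≠ Υ is a completion of an A-set Υ (all of whose groups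
consist of pairwise distinct points), then some group Ḡ of Ῡ carries a
not 2-connected graph, whose edges are the pairs of distinct points of Ḡ
contained in a common group of Υ.
-/

noncomputable section

section ASet

variable (m : ℕ) (A : Fin m → ℕ) (J : Fin m → Finset ℝ)

/-- The nodes of the two-color graph of the family `J`: the pairs `(j, x)`
with `x` a point of the group `J j`. -/
abbrev NodeA : Type := Σ j : Fin m, {x : ℝ // x ∈ J j}

/-- Black edges: they join `(j, x)` and `(j, x')` for `x ≠ x'` in the same
group. -/
def BlackAdjA (u v : NodeA m J) : Prop := u.1 = v.1 ∧ u.2.1 ≠ v.2.1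

/-- White edges: they join `(j, x)` and `(j', x')` whenever `j ≠ j'` and
`x = x'`. -/
def WhiteAdjA (u v : NodeA m J) : Prop := u.1 ≠ v.1 ∧ u.2.1 = v.2.1

/-- Adjacency in the two-color graph: a black or a white edge. -/
def TwoColorAdjA (u v : NodeA m J) : Prop := BlackAdjA m J u v ∨ WhiteAdjA m J u v

/-- Every cycle without repeating nodes in the two-color graph contains no
white edge (so `J` is an `A`-set). -/
def NoWhiteCycle : Prop :=
  ¬ ∃ (l : ℕ) (v : ℕ → NodeA m J), 3 ≤ l ∧
      (∀ i < l, ∀ i' < l, v i = v i' → i = i') ∧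
      (∀ i < l, TwoColorAdjA m J (v i) (v ((i + 1) % l))) ∧
      ∃ i < l, WhiteAdjA m J (v i) (v ((i + 1) % l))

end ASet

/-- One step of completion: two groups whose point sets intersect are replaced
by the single group equal to the union of their point sets. -/
def CompletionStep (F F' : Multiset (Finset ℝ)) : Prop :=
  ∃ (G₁ G₂ : Finset ℝ) (rest : Multiset (Finset ℝ)),
    F = G₁ ::ₘ G₂ ::ₘ rest ∧ (G₁ ∩ G₂).Nonempty ∧ F' = (G₁ ∪ G₂) ::ₘ rest

/-- A completion of a family of groups: any family obtained from it by a
finite sequence of completion steps. -/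
def IsCompletion (F F' : Multiset (Finset ℝ)) : Prop :=
  Relation.ReflTransGen CompletionStep F F'

/-- The graph on the node set `Ḡ` whose edges are the unordered pairs of
distinct points of `Ḡ` contained in a common group of the family `J`. -/
def graphOnGroup (m : ℕ) (J : Fin m → Finset ℝ) (Gbar : Finset ℝ) :
    SimpleGraph {x : ℝ // x ∈ Gbar} :=
  SimpleGraph.fromRel fun x y => ∃ j : Fin m, x.1 ∈ J j ∧ y.1 ∈ J j

/-- A graph is 2-connected if it is connected and, for each node, deleting
that node together with all incident edges leaves a connected graph on the
remaining nodes. -/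
def TwoConnSG {V : Type} (G : SimpleGraph V) : Prop :=
  G.Connected ∧ ∀ v : V, (G.induce {u | u ≠ v}).Connected

section TwoColorGraph

variable {m : ℕ} {J : Fin m → Finset ℝ}

/-- The two-color graph of the family `J`, with its colors forgotten. -/
def twoColorGraph (m : ℕ) (J : Fin m → Finset ℝ) : SimpleGraph (NodeA m J) where
  Adj := TwoColorAdjA m J
  symm := ⟨fun _ _ h => h.imp (fun h => ⟨h.1.symm, h.2.symm⟩) fun h => ⟨h.1.symm, h.2.symm⟩⟩
  loopless := ⟨fun _ h => h.elim (fun h => h.2 rfl) fun h => h.1 rfl⟩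

/-- A set of indices is linked if the nodes of its groups span a connected
subgraph of the two-color graph. -/
def Linked (J : Fin m → Finset ℝ) (S : Set (Fin m)) : Prop :=
  ((twoColorGraph m J).induce {u | u.1 ∈ S}).Connected

theorem linked_singleton {j : Fin m} (hj : (J j).Nonempty) : Linked J {j} := by
  obtain ⟨x, hx⟩ := hj
  refine @SimpleGraph.Connected.mk _ _ ?_ ⟨⟨⟨j, x, hx⟩, rfl⟩⟩
  rintro ⟨⟨i, y, hy⟩, hi⟩ ⟨⟨k, z, hz⟩, hk⟩
  obtain rfl : i = j := hi
  obtain rfl : k = i := hk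
  by_cases hyz : y = z
  · subst hyz
    exact SimpleGraph.Reachable.refl _
  · exact SimpleGraph.Adj.reachable (Or.inl ⟨rfl, hyz⟩)

theorem Linked.union {S T : Set (Fin m)} (hS : Linked J S) (hT : Linked J T)
    (hST : Disjoint S T) {a b : Fin m} (ha : a ∈ S) (hb : b ∈ T) {x : ℝ}
    (hxa : x ∈ J a) (hxb : x ∈ J b) : Linked J (S ∪ T) :=
  SimpleGraph.connected_induce_union (v := ⟨a, x, hxa⟩) (w := ⟨b, x, hxb⟩)
    hS.preconnected hT.preconnected ha hb
    (Or.inr ⟨hST.ne_of_mem ha hb, rfl⟩)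

theorem Linked.exists_isPath {S : Set (Fin m)} (hS : Linked J S) {u v : NodeA m J}
    (hu : u.1 ∈ S) (hv : v.1 ∈ S) :
    ∃ p : (twoColorGraph m J).Walk u v, p.IsPath ∧ ∀ w ∈ p.support, w.1 ∈ S := by
  obtain ⟨p, hp⟩ := (hS.preconnected ⟨u, hu⟩ ⟨v, hv⟩).exists_isPath
  have hmem : ∀ w ∈ (p.map (SimpleGraph.Embedding.induce _).toHom).support, w.1 ∈ S := by
    intro w hw
    rw [SimpleGraph.Walk.support_map, List.mem_map] at hw
    obtain ⟨w, -, rfl⟩ := hw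
    exact w.2
  exact ⟨_, hp.map Subtype.val_injective, hmem⟩

theorem not_whiteAdjA_of_isCycle (hset : NoWhiteCycle m J) {u v : NodeA m J}
    {h : (twoColorGraph m J).Adj u v} {p : (twoColorGraph m J).Walk v u}
    (hp : (SimpleGraph.Walk.cons h p).IsCycle) : ¬ WhiteAdjA m J u v := by
  intro hw
  have hlen := hp.three_le_length
  have hsucc : ∀ i < (SimpleGraph.Walk.cons h p).length,
      (SimpleGraph.Walk.cons h p).getVert ((i + 1) % (SimpleGraph.Walk.cons h p).length) =
        (SimpleGraph.Walk.cons h p).getVert (i + 1) := by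
    intro i hi
    rcases Nat.lt_or_ge (i + 1) (SimpleGraph.Walk.cons h p).length with hlt | hge
    · rw [Nat.mod_eq_of_lt hlt]
    · rw [le_antisymm hi hge, Nat.mod_self, SimpleGraph.Walk.getVert_zero,
        SimpleGraph.Walk.getVert_length]
  refine hset ⟨_, (SimpleGraph.Walk.cons h p).getVert, hlen, ?_, ?_, 0, by lia, ?_⟩
  · intro i hi k hk hik
    exact hp.getVert_injOn' (Nat.le_sub_one_of_lt hi) (Nat.le_sub_one_of_lt hk) hik
  · intro i hi
    rw [hsucc i hi]
    exact (SimpleGraph.Walk.cons h p).adj_getVert_succ hi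
  · rw [hsucc 0 (by lia)]
    simpa using hw

/-- The point sets of two disjoint linked sets of groups share at most one point. -/
theorem Linked.eq_of_mem (hset : NoWhiteCycle m J) {S T : Set (Fin m)}
    (hS : Linked J S) (hT : Linked J T) (hST : Disjoint S T) {a b c d : Fin m}
    (ha : a ∈ S) (hb : b ∈ T) (hc : c ∈ S) (hd : d ∈ T) {x y : ℝ}
    (hxa : x ∈ J a) (hxb : x ∈ J b) (hyc : y ∈ J c) (hyd : y ∈ J d) : x = y := by
  by_contra hxy
  have hne : ∀ {i k : Fin m}, i ∈ S → k ∈ T → i ≠ k :=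
    fun hi hk => hST.ne_of_mem hi hk
  obtain ⟨p, hp, hpS⟩ := hS.exists_isPath (u := ⟨a, x, hxa⟩) (v := ⟨c, y, hyc⟩) ha hc
  obtain ⟨q, hq, hqT⟩ := hT.exists_isPath (u := ⟨d, y, hyd⟩) (v := ⟨b, x, hxb⟩) hd hb
  have hcd : (twoColorGraph m J).Adj ⟨c, y, hyc⟩ ⟨d, y, hyd⟩ := Or.inr ⟨hne hc hd, rfl⟩
  have hba : WhiteAdjA m J ⟨b, x, hxb⟩ ⟨a, x, hxa⟩ := ⟨(hne ha hb).symm, rfl⟩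
  have hadj : (twoColorGraph m J).Adj ⟨b, x, hxb⟩ ⟨a, x, hxa⟩ := Or.inr hba
  have hcycle : (SimpleGraph.Walk.cons hadj (p.append (.cons hcd q))).IsCycle := by
    rw [SimpleGraph.Walk.cons_isCycle_iff]
    constructor
    · rw [SimpleGraph.Walk.isPath_def, SimpleGraph.Walk.support_append,
        SimpleGraph.Walk.support_cons, List.tail_cons, List.nodup_append]
      exact ⟨hp.support_nodup, hq.support_nodup,
        fun u hu v hv huv => hne (hpS u hu) (hqT v hv) (congrArg Sigma.fst huv)⟩
    · rw [SimpleGraph.Walk.edges_append, SimpleGraph.Walk.edges_cons, List.mem_append,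
        List.mem_cons]
      rintro (h | h | h)
      · exact hne (hpS _ (p.fst_mem_support_of_mem_edges h)) hb rfl
      · rcases Sym2.eq_iff.1 h with ⟨h, -⟩ | ⟨h, -⟩
        · exact hne hc hb (congrArg Sigma.fst h).symm
        · exact hxy (congrArg (fun u : NodeA m J => u.2.1) h)
      · exact hne ha (hqT _ (q.snd_mem_support_of_mem_edges h)) rfl
  exact not_whiteAdjA_of_isCycle hset hcycle hba

/-- Points of two disjoint linked sets of groups with a common point `z` do not
lie in a common group unless one of them is `z`. -/
theorem Linked.eq_or_eq_of_mem (hset : NoWhiteCycle m J) {S T : Set (Fin m)}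
    (hS : Linked J S) (hT : Linked J T) (hST : Disjoint S T) {a b c d e : Fin m}
    (ha : a ∈ S) (hb : b ∈ T) (hc : c ∈ S) (hd : d ∈ T) {x y z : ℝ}
    (hza : z ∈ J a) (hzb : z ∈ J b) (hxc : x ∈ J c) (hyd : y ∈ J d)
    (hxe : x ∈ J e) (hye : y ∈ J e) : z = x ∨ z = y := by
  by_cases heT : e ∈ T
  · exact Or.inl (hS.eq_of_mem hset hT hST ha hb hc heT hza hzb hxc hxe)
  by_cases heS : e ∈ S
  · exact Or.inr (hS.eq_of_mem hset hT hST ha hb heS hd hza hzb hye hyd)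
  have hSe : Linked J (S ∪ {e}) :=
    hS.union (linked_singleton ⟨x, hxe⟩) (Set.disjoint_singleton_right.2 heS) hc rfl hxc hxe
  exact Or.inr (hSe.eq_of_mem hset hT
    (Set.disjoint_union_left.2 ⟨hST, Set.disjoint_singleton_left.2 heT⟩)
    (Or.inl ha) hb (Or.inr rfl) hd hza hzb hye hyd)

/-- The union of the groups with indices in `S`. -/
def groupUnion (J : Fin m → Finset ℝ) (S : Multiset (Fin m)) : Finset ℝ :=
  S.toFinset.biUnion J

theorem mem_groupUnion {S : Multiset (Fin m)} {x : ℝ} :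
    x ∈ groupUnion J S ↔ ∃ j ∈ S, x ∈ J j := by
  simp [groupUnion]

theorem groupUnion_add (S T : Multiset (Fin m)) :
    groupUnion J (S + T) = groupUnion J S ∪ groupUnion J T := by
  ext x
  simp only [mem_groupUnion, Finset.mem_union, Multiset.mem_add, or_and_right, exists_or]

/-- A family of groups is linked over `J` if it consists of the unions of
groups of `J` over pairwise disjoint linked sets of indices. -/
def IsLinkedFamily (J : Fin m → Finset ℝ) (F : Multiset (Finset ℝ)) : Prop :=
  ∃ P : Multiset (Multiset (Fin m)), F = P.map (groupUnion J) ∧ P.join.Nodup ∧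
    ∀ S ∈ P, Linked J {j | j ∈ S}

theorem isLinkedFamily_map (hJ : ∀ j, (J j).Nonempty) :
    IsLinkedFamily J (Finset.univ.val.map J) := by
  refine ⟨Finset.univ.val.map fun j => {j}, ?_, ?_, ?_⟩
  · rw [Multiset.map_map]
    refine Multiset.map_congr rfl fun j _ => ?_
    simp [groupUnion]
  · change (Finset.univ.val.bind fun j : Fin m => {j}).Nodup
    rw [Multiset.bind_singleton, Multiset.map_id']
    exact Finset.univ.nodup
  · intro S hS
    obtain ⟨j, -, rfl⟩ := Multiset.mem_map.1 hS
    simpa using linked_singleton (hJ j)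

theorem IsLinkedFamily.exists_of_cons_cons {G₁ G₂ : Finset ℝ} {F : Multiset (Finset ℝ)}
    (h : IsLinkedFamily J (G₁ ::ₘ G₂ ::ₘ F)) :
    ∃ (S T : Multiset (Fin m)) (P : Multiset (Multiset (Fin m))),
      G₁ = groupUnion J S ∧ G₂ = groupUnion J T ∧ F = P.map (groupUnion J) ∧
      (S ::ₘ T ::ₘ P).join.Nodup ∧ ∀ R ∈ S ::ₘ T ::ₘ P, Linked J {j | j ∈ R} := by
  obtain ⟨P, hF, hP, hlink⟩ := h
  obtain ⟨S, hS, rfl, hPS⟩ := (Multiset.map_eq_cons _ _ _ _).2 hF.symm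
  obtain ⟨T, hT, rfl, hPT⟩ := (Multiset.map_eq_cons _ _ _ _).2 hPS
  have hST : S ::ₘ T ::ₘ (P.erase S).erase T = P := by
    rw [Multiset.cons_erase hT, Multiset.cons_erase hS]
  exact ⟨S, T, (P.erase S).erase T, rfl, rfl, hPT.symm, by rwa [hST], by rwa [hST]⟩

theorem disjoint_of_nodup_join_cons_cons {S T : Multiset (Fin m)}
    {P : Multiset (Multiset (Fin m))} (h : (S ::ₘ T ::ₘ P).join.Nodup) :
    Disjoint {j | j ∈ S} {j | j ∈ T} := by
  rw [Multiset.join_cons, Multiset.join_cons, ← add_assoc] at h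
  have h' := (Multiset.nodup_add.1 (Multiset.nodup_add.1 h).1).2.2
  exact Set.disjoint_left.2 fun _ hS hT => Multiset.disjoint_left.1 h' hS hT

theorem IsLinkedFamily.completionStep {F F' : Multiset (Finset ℝ)}
    (h : IsLinkedFamily J F) (hstep : CompletionStep F F') : IsLinkedFamily J F' := by
  obtain ⟨G₁, G₂, F, rfl, ⟨x, hx⟩, rfl⟩ := hstep
  obtain ⟨S, T, P, rfl, rfl, rfl, hP, hlink⟩ := h.exists_of_cons_cons
  obtain ⟨hxS, hxT⟩ := Finset.mem_inter.1 hx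
  obtain ⟨a, ha, hxa⟩ := mem_groupUnion.1 hxS
  obtain ⟨b, hb, hxb⟩ := mem_groupUnion.1 hxT
  refine ⟨(S + T) ::ₘ P, ?_, ?_, ?_⟩
  · rw [Multiset.map_cons, groupUnion_add]
  · simpa only [Multiset.join_cons, add_assoc] using hP
  · intro R hR
    rcases Multiset.mem_cons.1 hR with rfl | hR
    · have hunion := (hlink S (by simp)).union (hlink T (by simp))
        (disjoint_of_nodup_join_cons_cons hP) ha hb hxa hxb
      convert hunion using 1
      ext j
      simp
    · exact hlink R (by simp [hR])

theorem exists_ne_mem_groupUnion (hJ : ∀ j, 2 ≤ (J j).card) {S : Multiset (Fin m)} {j : Fin m}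
    (hj : j ∈ S) (x : ℝ) : ∃ y ∈ groupUnion J S, y ≠ x := by
  obtain ⟨y, hy, hyx⟩ := Finset.exists_mem_ne (hJ j) x
  exact ⟨y, mem_groupUnion.2 ⟨j, hj, hy⟩, hyx⟩

/-- The common point of the point sets of two disjoint linked sets of groups is
a cut point of their union. -/
theorem not_twoConnSG_groupUnion (hJ : ∀ j, 2 ≤ (J j).card) (hset : NoWhiteCycle m J)
    {S T : Multiset (Fin m)} (hS : Linked J {j | j ∈ S}) (hT : Linked J {j | j ∈ T})
    (hST : Disjoint {j | j ∈ S} {j | j ∈ T})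
    (hinter : (groupUnion J S ∩ groupUnion J T).Nonempty) :
    ¬ TwoConnSG (graphOnGroup m J (groupUnion J S ∪ groupUnion J T)) := by
  intro htwo
  obtain ⟨z, hz⟩ := hinter
  obtain ⟨hzS, hzT⟩ := Finset.mem_inter.1 hz
  obtain ⟨a, ha, hza⟩ := mem_groupUnion.1 hzS
  obtain ⟨b, hb, hzb⟩ := mem_groupUnion.1 hzT
  obtain ⟨x, hxS, hxz⟩ := exists_ne_mem_groupUnion hJ ha z
  obtain ⟨y, hyT, hyz⟩ := exists_ne_mem_groupUnion hJ hb z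
  have hconn := htwo.2 ⟨z, Finset.mem_union_left _ hzS⟩
  obtain ⟨p⟩ := hconn.preconnected
    ⟨⟨x, Finset.mem_union_left _ hxS⟩, fun h => hxz (congrArg Subtype.val h)⟩
    ⟨⟨y, Finset.mem_union_right _ hyT⟩, fun h => hyz (congrArg Subtype.val h)⟩
  have hwalk : ∀ {u v : {w | w ≠ (⟨z, Finset.mem_union_left _ hzS⟩ :
      {x // x ∈ groupUnion J S ∪ groupUnion J T})}},
      ((graphOnGroup m J (groupUnion J S ∪ groupUnion J T)).induce _).Walk u v → u.1.1 ∈ groupUnion J S → v.1.1 ∈ groupUnion J S := by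
    intro u v p
    induction p with
    | nil => exact id
    | @cons u w v huw p ih =>
      intro hu
      refine ih ?_
      rcases Finset.mem_union.1 w.1.2 with hw | hw
      · exact hw
      exfalso
      obtain ⟨c, hc, huc⟩ := mem_groupUnion.1 hu
      obtain ⟨d, hd, hwd⟩ := mem_groupUnion.1 hw
      obtain ⟨e, hue, hwe⟩ : ∃ e, u.1.1 ∈ J e ∧ w.1.1 ∈ J e := by
        rcases huw.2 with ⟨e, h₁, h₂⟩ | ⟨e, h₁, h₂⟩
        · exact ⟨e, h₁, h₂⟩
        · exact ⟨e, h₂, h₁⟩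
      rcases hS.eq_or_eq_of_mem hset hT hST ha hb hc hd hza hzb huc hwd hue hwe with h | h
      · exact u.2 (Subtype.ext h.symm)
      · exact w.2 (Subtype.ext h.symm)
  obtain ⟨c, hc, hyc⟩ := mem_groupUnion.1 (hwalk p hxS)
  obtain ⟨d, hd, hyd⟩ := mem_groupUnion.1 hyT
  exact hyz (hS.eq_of_mem hset hT hST ha hb hc hd hza hzb hyc hyd).symm

end TwoColorGraph

/-- Let `Υ = (J j)` be an `A`-set all of whose groups consist
of pairwise distinct points, and let `Ῡ` be a completion of `Υ` with `Ῡ ≠ Υ`.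
Then there exists a group `Ḡ` of `Ῡ` such that the graph whose node set is `Ḡ`
and whose edges are the unordered pairs of distinct points of `Ḡ` contained in
a common group of `Υ` is not 2-connected. -/
theorem completion_face_not_two_connected (m : ℕ) (A : Fin m → ℕ)
    (hA : ∀ j, 2 ≤ A j) (J : Fin m → Finset ℝ) (hcard : ∀ j, (J j).card = A j)
    (hset : NoWhiteCycle m J)
    (Ubar : Multiset (Finset ℝ))
    (hcompl : IsCompletion (Finset.univ.val.map J) Ubar)
    (hne : Ubar ≠ Finset.univ.val.map J) :
    ∃ Gbar ∈ Ubar, ¬ TwoConnSG (graphOnGroup m J Gbar) := by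
  have hJ : ∀ j, 2 ≤ (J j).card := fun j => hcard j ▸ hA j
  have hlinked : ∀ F, IsCompletion (Finset.univ.val.map J) F → IsLinkedFamily J F := by
    intro F hF
    induction hF with
    | refl => exact isLinkedFamily_map fun j => Finset.card_pos.1 (by have := hJ j; lia)
    | tail _ hstep ih => exact ih.completionStep hstep
  rcases Relation.ReflTransGen.cases_tail hcompl with h | ⟨F, hF, G₁, G₂, rest, rfl, hinter, rfl⟩
  · exact absurd h hne
  obtain ⟨S, T, P, rfl, rfl, -, hP, hlink⟩ := (hlinked _ hF).exists_of_cons_cons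
  exact ⟨_, Multiset.mem_cons_self _ _, not_twoConnSG_groupUnion hJ hset
    (hlink S (by simp)) (hlink T (by simp)) (disjoint_of_nodup_join_cons_cons hP) hinter⟩

end
end

section
/- Let Ψ = {(t,t') ∈ ℝ² : t ≤ t'} be the closed half-plane. For every integer k ≥ 1 and every degree i, the reduced singular homology with ℤ coefficients of the one-point compactification of the unordered configuration space B(Ψ,k) vanishes: H̃_i(B(Ψ,k)⁺; ℤ) = 0. -/
/-!
Statement 10: For Ψ = {(t,t′) ∈ ℝ² : t ≤ t′} and every k ≥ 1, the reduced
singular homology with ℤ coefficients of the one-point compactification of the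
unordered configuration space B(Ψ,k) vanishes in every degree.
-/

set_option autoImplicit false

noncomputable section

open Finset

/-! ### Reduced singular homology -/

/-- The standard topological `i`-simplex. -/
abbrev Spx (i : ℕ) : Type := (stdSimplex ℝ (Fin (i + 1)) : Set (Fin (i + 1) → ℝ))

/-- The value of the `j`-th face embedding `Δ^i → Δ^{i+1}`. -/
def faceVal (i : ℕ) (j : Fin (i + 2)) (x : Spx i) : Fin (i + 2) → ℝ :=
  fun l => ∑ m ∈ Finset.univ.filter (fun m : Fin (i + 1) => j.succAbove m = l), x.1 m

lemma faceVal_mem (i : ℕ) (j : Fin (i + 2)) (x : Spx i) :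
    faceVal i j x ∈ stdSimplex ℝ (Fin (i + 2)) := by
  obtain ⟨h1, h2⟩ := x.2
  constructor
  · intro l
    exact Finset.sum_nonneg fun m _ => h1 m
  · rw [show ∑ l, faceVal i j x l =
      ∑ l, ∑ m ∈ Finset.univ.filter (fun m : Fin (i + 1) => j.succAbove m = l), x.1 m from rfl]
    rw [Finset.sum_fiberwise]
    exact h2

/-- The `j`-th face map `Δ^i → Δ^{i+1}` of standard simplices. -/
def faceMap (i : ℕ) (j : Fin (i + 2)) : C(Spx i, Spx (i + 1)) :=
  ⟨fun x => ⟨faceVal i j x, faceVal_mem i j x⟩, by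
    apply Continuous.subtype_mk
    apply continuous_pi
    intro l
    exact continuous_finset_sum _ fun m _ => (continuous_apply m).comp continuous_subtype_val⟩

variable (Y : Type) [TopologicalSpace Y]

/-- Singular `i`-simplices of `Y`. -/
abbrev Sing (i : ℕ) : Type := C(Spx i, Y)

/-- The augmented singular chain complex of `Y`: in degree `0` the group `ℤ`,
in degree `i + 1` the free abelian group on the singular `i`-simplices. -/
def RC : ℕ → Type
  | 0 => ℤ
  | (i + 1) => Sing Y i →₀ ℤ

instance : ∀ d, AddCommGroup (RC Y d)
  | 0 => inferInstanceAs (AddCommGroup ℤ)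
  | (i + 1) => inferInstanceAs (AddCommGroup (Sing Y i →₀ ℤ))

instance : ∀ d, Module ℤ (RC Y d)
  | 0 => inferInstanceAs (Module ℤ ℤ)
  | (i + 1) => inferInstanceAs (Module ℤ (Sing Y i →₀ ℤ))

/-- The boundary operators of the augmented singular chain complex: in lowest
degree the augmentation (the sum of the coefficients), in higher degrees the
alternating sum `∂σ = Σ_j (−1)^j (σ ∘ δ_j)` over the faces. -/
def rbdry : ∀ d : ℕ, RC Y (d + 1) →ₗ[ℤ] RC Y d
  | 0 => Finsupp.lift ℤ ℤ (Sing Y 0) fun _ => (1 : ℤ)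
  | (i + 1) => Finsupp.lift (RC Y (i + 1)) ℤ (Sing Y (i + 1)) fun σ =>
      ∑ j : Fin (i + 2), ((-1 : ℤ) ^ (j : ℕ)) •
        Finsupp.single (σ.comp (faceMap i j)) (1 : ℤ)

/-- The reduced singular homology of `Y` with integer coefficients, in
degree `i`: cycles (of the augmented complex) modulo boundaries. -/
abbrev RedHomology (i : ℕ) : Type :=
  LinearMap.ker (rbdry Y i) ⧸
    Submodule.comap (LinearMap.ker (rbdry Y i)).subtype (LinearMap.range (rbdry Y (i + 1)))

end

noncomputable section

/-! ### Unordered configuration spaces -/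

/-- Injective `k`-tuples in `X`, with the subspace topology. -/
abbrev InjTuple (X : Type) (k : ℕ) : Type := {f : Fin k → X // Function.Injective f}

/-- Two injective tuples are equivalent iff they differ by a permutation of
the indices, i.e. have the same image. -/
def configSetoid (X : Type) (k : ℕ) : Setoid (InjTuple X k) where
  r f g := ∃ σ : Equiv.Perm (Fin k), f.1 = g.1 ∘ σ
  iseqv := by
    constructor
    · exact fun f => ⟨1, by funext x; simp⟩
    · rintro f g ⟨σ, h⟩
      refine ⟨σ⁻¹, ?_⟩
      funext x
      rw [h]
      simp
    · rintro f g h ⟨σ, hfg⟩ ⟨τ, hgh⟩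
      refine ⟨τ * σ, ?_⟩
      funext x
      rw [hfg, hgh]
      simp

/-- The unordered configuration space `B(X, k)` of `k`-element subsets of `X`:
the quotient of the space of injective `k`-tuples by the permutation action,
with the quotient topology. -/
abbrev Config (X : Type) [TopologicalSpace X] (k : ℕ) : Type := Quotient (configSetoid X k)

/-- The closed half-plane `Ψ = {(t, t′) ∈ ℝ² : t ≤ t′}`. -/
abbrev Psi : Type := {p : ℝ × ℝ // p.1 ≤ p.2}

end



section ContractibleHomology

/-- The map `[0,1] × Δ^i → Δ^{i+1}` exhibiting `Δ^{i+1}` as the join of its zeroth vertex with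
the opposite face. -/
noncomputable def joinMap (i : ℕ) : C(unitInterval × Spx i, Spx (i + 1)) where
  toFun p := ⟨Fin.cons (p.1 : ℝ) fun m => (1 - (p.1 : ℝ)) * p.2.1 m, by
    constructor
    · refine Fin.cases p.1.2.1 fun m => ?_
      simpa using mul_nonneg (sub_nonneg.2 p.1.2.2) (p.2.2.1 m)
    · rw [Fin.sum_univ_succ]
      simp only [Fin.cons_zero, Fin.cons_succ, ← Finset.mul_sum, p.2.2.2]
      ring⟩
  continuous_toFun := by
    refine Continuous.subtype_mk (continuous_pi ?_) _
    refine Fin.cases ?_ fun m => ?_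
    · simp only [Fin.cons_zero]; fun_prop
    · simp only [Fin.cons_succ]
      exact (continuous_const.sub (continuous_subtype_val.comp continuous_fst)).mul
        ((continuous_apply m).comp (continuous_subtype_val.comp continuous_snd))

@[simp] lemma joinMap_zero_coord (i : ℕ) (p : unitInterval × Spx i) : (joinMap i p).1 0 = p.1 := rfl

@[simp] lemma joinMap_succ_coord (i : ℕ) (p : unitInterval × Spx i) (m : Fin (i + 1)) :
    (joinMap i p).1 m.succ = (1 - (p.1 : ℝ)) * p.2.1 m := rfl

lemma joinMap_surjective (i : ℕ) : Function.Surjective (joinMap i) := by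
  intro y
  have hsum : y.1 0 + ∑ m : Fin (i + 1), y.1 m.succ = 1 := by
    rw [← Fin.sum_univ_succ]; exact y.2.2
  have hpos : ∀ m : Fin (i + 1), 0 ≤ y.1 m.succ := fun m => y.2.1 _
  have hle : y.1 0 ≤ 1 := by
    have := Finset.sum_nonneg fun m (_ : m ∈ Finset.univ) => hpos m
    linarith
  rcases eq_or_ne (y.1 0) 1 with h | h
  · have hz : ∀ m : Fin (i + 1), y.1 m.succ = 0 := by
      have h0 : ∑ m : Fin (i + 1), y.1 m.succ = 0 := by linarith
      exact fun m => (Finset.sum_eq_zero_iff_of_nonneg fun m _ => hpos m).1 h0 m (Finset.mem_univ m)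
    refine ⟨(1, ⟨Pi.single 0 1, single_mem_stdSimplex ℝ 0⟩), Subtype.ext (funext ?_)⟩
    refine Fin.cases ?_ fun m => ?_
    · simp [h]
    · simp [hz]
  · have hd : 0 < 1 - y.1 0 := sub_pos.2 (lt_of_le_of_ne hle h)
    refine ⟨(⟨y.1 0, y.2.1 0, hle⟩, ⟨fun m => y.1 m.succ / (1 - y.1 0),
      fun m => div_nonneg (hpos m) hd.le, ?_⟩), Subtype.ext (funext ?_)⟩
    · rw [← Finset.sum_div, div_eq_one_iff_eq hd.ne']; linarith
    · refine Fin.cases ?_ fun m => ?_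
      · simp
      · simp only [joinMap_succ_coord]; field_simp

lemma isQuotientMap_joinMap (i : ℕ) : Topology.IsQuotientMap (joinMap i) :=
  .of_surjective_continuous (joinMap_surjective i) (joinMap i).continuous

lemma joinMap_eq_joinMap (i : ℕ) (p q : unitInterval × Spx i) :
    joinMap i p = joinMap i q → p = q ∨ p.1 = 1 ∧ q.1 = 1 := by
  intro h
  have h0 : p.1 = q.1 := Subtype.ext (congrArg (fun z : Spx (i + 1) => z.1 0) h)
  by_cases h1 : p.1 = 1
  · exact .inr ⟨h1, h0 ▸ h1⟩
  · refine .inl (Prod.ext h0 (Subtype.ext (funext fun m => ?_)))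
    have hm := congrArg (fun z : Spx (i + 1) => z.1 m.succ) h
    simp only [joinMap_succ_coord, ← h0] at hm
    exact mul_left_cancel₀ (sub_ne_zero.2 fun h' => h1 (Subtype.ext h'.symm)) hm

lemma faceMap_apply_succAbove (i : ℕ) (j : Fin (i + 2)) (x : Spx i) (m : Fin (i + 1)) :
    (faceMap i j x).1 (j.succAbove m) = x.1 m := by
  simp [faceMap, faceVal, Finset.filter_eq']

lemma faceMap_apply_self (i : ℕ) (j : Fin (i + 2)) (x : Spx i) : (faceMap i j x).1 j = 0 := by
  simp [faceMap, faceVal, Fin.succAbove_ne]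

lemma faceMap_zero_eq (i : ℕ) (x : Spx i) : faceMap i 0 x = joinMap i (0, x) := by
  refine Subtype.ext (funext ?_)
  refine Fin.cases (by simp [faceMap_apply_self]) fun m => ?_
  rw [← Fin.succAbove_zero_apply, faceMap_apply_succAbove]
  simp

lemma faceMap_succ_joinMap (i : ℕ) (j : Fin (i + 2)) (p : unitInterval × Spx i) :
    faceMap (i + 1) j.succ (joinMap i p) = joinMap (i + 1) (p.1, faceMap i j p.2) := by
  refine Subtype.ext (funext fun l => ?_)
  rcases Fin.eq_self_or_eq_succAbove j.succ l with rfl | ⟨m, rfl⟩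
  · simp [faceMap_apply_self]
  · rw [faceMap_apply_succAbove]
    refine Fin.cases ?_ (fun m => ?_) m
    · simp
    · simp [faceMap_apply_succAbove]

lemma faceMap_one_eq (x : Spx 0) : faceMap 0 1 x = joinMap 0 (1, x) := by
  refine Subtype.ext (funext fun l => ?_)
  have hx : x.1 0 = 1 := by simpa using x.2.2
  fin_cases l
  · exact (faceMap_apply_succAbove 0 1 x 0).trans hx
  · exact (faceMap_apply_self 0 1 x).trans (by simpa using (joinMap_succ_coord 0 (1, x) 0).symm)

variable {Y : Type} [TopologicalSpace Y] {y₀ : Y}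
  (H : (ContinuousMap.id Y).Homotopy (ContinuousMap.const Y y₀))

lemma homotopy_factorsThrough_joinMap {i : ℕ} (σ : Sing Y i) : Function.FactorsThrough
    (H.toContinuousMap.comp ((ContinuousMap.id unitInterval).prodMap σ)) (joinMap i) := by
  intro p q h
  rcases joinMap_eq_joinMap i p q h with rfl | ⟨hp, hq⟩
  · rfl
  · obtain ⟨s, x⟩ := p
    obtain ⟨t, y⟩ := q
    obtain rfl : s = 1 := hp
    obtain rfl : t = 1 := hq
    exact (H.apply_one (σ x)).trans (H.apply_one (σ y)).symm

/-- The cone on a singular simplex determined by a contraction of the space. -/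
noncomputable def coneSimplex {i : ℕ} (σ : Sing Y i) : Sing Y (i + 1) :=
  (isQuotientMap_joinMap i).lift _ (homotopy_factorsThrough_joinMap H σ)

lemma coneSimplex_joinMap {i : ℕ} (σ : Sing Y i) (p : unitInterval × Spx i) :
    coneSimplex H σ (joinMap i p) = H (p.1, σ p.2) :=
  DFunLike.congr_fun ((isQuotientMap_joinMap i).lift_comp _
    (homotopy_factorsThrough_joinMap H σ)) p

lemma coneSimplex_comp_faceMap_zero {i : ℕ} (σ : Sing Y i) :
    (coneSimplex H σ).comp (faceMap i 0) = σ := by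
  ext x
  simp [faceMap_zero_eq, coneSimplex_joinMap]

lemma coneSimplex_comp_faceMap_succ {i : ℕ} (σ : Sing Y (i + 1)) (j : Fin (i + 2)) :
    (coneSimplex H σ).comp (faceMap (i + 1) j.succ) = coneSimplex H (σ.comp (faceMap i j)) := by
  ext x
  obtain ⟨p, rfl⟩ := joinMap_surjective i x
  simp [faceMap_succ_joinMap, coneSimplex_joinMap]

lemma coneSimplex_comp_faceMap_one (σ : Sing Y 0) :
    (coneSimplex H σ).comp (faceMap 0 1) = ContinuousMap.const _ y₀ := by
  ext x
  simp [faceMap_one_eq, coneSimplex_joinMap]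

/-- The cone operator on the augmented singular chain complex. -/
noncomputable def coneOperator : ∀ d : ℕ, RC Y d →ₗ[ℤ] RC Y (d + 1)
  | 0 => LinearMap.toSpanSingleton ℤ (Sing Y 0 →₀ ℤ)
      (Finsupp.single (ContinuousMap.const _ y₀) 1)
  | (i + 1) => Finsupp.lift (RC Y (i + 2)) ℤ (Sing Y i) fun σ =>
      (Finsupp.single (coneSimplex H σ) (1 : ℤ) : Sing Y (i + 1) →₀ ℤ)

lemma Finsupp.lift_apply_single_one {M S : Type} [AddCommMonoid M] [Module ℤ M] (f : S → M)
    (x : S) : Finsupp.lift M ℤ S f (Finsupp.single x 1) = f x := by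
  simp

lemma rbdry_zero_single (σ : Sing Y 0) :
    rbdry Y 0 (Finsupp.single σ (1 : ℤ) : Sing Y 0 →₀ ℤ) = (1 : ℤ) :=
  Finsupp.lift_apply_single_one (M := ℤ) (fun _ => (1 : ℤ)) σ

lemma rbdry_succ_single (i : ℕ) (σ : Sing Y (i + 1)) :
    rbdry Y (i + 1) (Finsupp.single σ (1 : ℤ) : Sing Y (i + 1) →₀ ℤ) =
      (∑ j : Fin (i + 2), ((-1 : ℤ) ^ (j : ℕ)) •
        Finsupp.single (σ.comp (faceMap i j)) (1 : ℤ) : Sing Y i →₀ ℤ) :=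
  Finsupp.lift_apply_single_one _ σ

lemma coneOperator_succ_single (i : ℕ) (σ : Sing Y i) :
    coneOperator H (i + 1) (Finsupp.single σ (1 : ℤ) : Sing Y i →₀ ℤ) =
      (Finsupp.single (coneSimplex H σ) (1 : ℤ) : Sing Y (i + 1) →₀ ℤ) :=
  Finsupp.lift_apply_single_one _ σ

lemma rbdry_comp_coneOperator_add (d : ℕ) :
    rbdry Y (d + 1) ∘ₗ coneOperator H (d + 1) + coneOperator H d ∘ₗ rbdry Y d =
      LinearMap.id := by
  refine Finsupp.lhom_ext' fun σ => LinearMap.ext_ring ?_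
  change rbdry Y (d + 1) (coneOperator H (d + 1) (Finsupp.single σ (1 : ℤ) : Sing Y d →₀ ℤ)) +
    coneOperator H d (rbdry Y d (Finsupp.single σ (1 : ℤ) : Sing Y d →₀ ℤ)) =
      (Finsupp.single σ (1 : ℤ) : Sing Y d →₀ ℤ)
  rw [coneOperator_succ_single, rbdry_succ_single, Fin.sum_univ_succ,
    coneSimplex_comp_faceMap_zero]
  cases d with
  | zero =>
    rw [rbdry_zero_single]
    change (_ : Sing Y 0 →₀ ℤ) + (1 : ℤ) • (Finsupp.single (ContinuousMap.const _ y₀) 1) = _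
    simp [coneSimplex_comp_faceMap_one]
  | succ i =>
    rw [rbdry_succ_single]
    have hc : coneOperator H (i + 1) (∑ j : Fin (i + 2), ((-1 : ℤ) ^ (j : ℕ)) •
        Finsupp.single (σ.comp (faceMap i j)) (1 : ℤ) : Sing Y i →₀ ℤ) =
        (∑ j : Fin (i + 2), ((-1 : ℤ) ^ (j : ℕ)) •
          Finsupp.single (coneSimplex H (σ.comp (faceMap i j))) (1 : ℤ) : Sing Y (i + 1) →₀ ℤ) := by
      refine (map_sum (coneOperator H (i + 1)) _ _).trans (Finset.sum_congr rfl fun j _ => ?_)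
      exact (map_smul (coneOperator H (i + 1)) _ _).trans
        (congrArg _ (coneOperator_succ_single H i _))
    refine (congrArg _ hc).trans ?_
    change (_ : Sing Y (i + 1) →₀ ℤ) + (_ : Sing Y (i + 1) →₀ ℤ) = _
    simp only [coneSimplex_comp_faceMap_succ, Fin.val_zero, pow_zero, one_smul, Fin.val_succ,
      pow_succ, mul_neg, mul_one, neg_smul, Finset.sum_neg_distrib, neg_add_cancel_right]

/-- A contractible space has vanishing reduced singular homology. -/
theorem subsingleton_redHomology_of_contractible (Y : Type) [TopologicalSpace Y]
    [ContractibleSpace Y] (i : ℕ) : Subsingleton (RedHomology Y i) := by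
  obtain ⟨y₀, ⟨H⟩⟩ := id_nullhomotopic Y
  rw [Submodule.Quotient.subsingleton_iff, eq_top_iff]
  rintro ⟨z, hz⟩ -
  have h := LinearMap.congr_fun (rbdry_comp_coneOperator_add H i) z
  refine ⟨coneOperator H (i + 1) z, ?_⟩
  simpa [LinearMap.mem_ker.1 hz] using h

end ContractibleHomology

section ConfigurationSpace

variable {X : Type} [TopologicalSpace X] {k : ℕ}

/-- The projection from injective tuples to unordered configurations. -/
abbrev toConfig (f : InjTuple X k) : Config X k := Quotient.mk (configSetoid X k) f

/-- The action of a permutation of the indices on injective tuples. -/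
def permTuple (τ : Equiv.Perm (Fin k)) (f : InjTuple X k) : InjTuple X k :=
  ⟨f.1 ∘ τ, f.2.comp τ.injective⟩

lemma continuous_permTuple (τ : Equiv.Perm (Fin k)) :
    Continuous (permTuple τ : InjTuple X k → InjTuple X k) :=
  Continuous.subtype_mk (f := fun f : InjTuple X k => f.1 ∘ τ)
    (continuous_pi fun m => (continuous_apply (τ m)).comp continuous_subtype_val) _

lemma toConfig_eq_toConfig_iff {f g : InjTuple X k} :
    toConfig f = toConfig g ↔ ∃ τ, f = permTuple τ g :=
  Quotient.eq.trans (exists_congr fun τ => (Subtype.ext_iff (a2 := permTuple τ g)).symm)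

lemma toConfig_permTuple (τ : Equiv.Perm (Fin k)) (f : InjTuple X k) :
    toConfig (permTuple τ f) = toConfig f :=
  toConfig_eq_toConfig_iff.2 ⟨τ, rfl⟩

lemma preimage_image_toConfig (s : Set (InjTuple X k)) :
    toConfig ⁻¹' (toConfig '' s) = ⋃ τ, permTuple τ ⁻¹' s := by
  ext f
  simp only [Set.mem_preimage, Set.mem_image, Set.mem_iUnion]
  constructor
  · rintro ⟨g, hg, h⟩
    obtain ⟨τ, rfl⟩ := toConfig_eq_toConfig_iff.1 h
    exact ⟨τ, hg⟩
  · rintro ⟨τ, h⟩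
    exact ⟨_, h, toConfig_permTuple τ f⟩

lemma continuous_toConfig : Continuous (toConfig : InjTuple X k → Config X k) :=
  continuous_quotient_mk'

lemma isOpenQuotientMap_toConfig :
    IsOpenQuotientMap (toConfig : InjTuple X k → Config X k) where
  surjective := Quotient.mk_surjective
  continuous := continuous_toConfig
  isOpenMap s hs := by
    rw [← isQuotientMap_quotient_mk'.isOpen_preimage]
    change IsOpen (toConfig ⁻¹' (toConfig '' s))
    rw [preimage_image_toConfig]
    exact isOpen_iUnion fun τ => hs.preimage (continuous_permTuple τ)

lemma isProperMap_toConfig : IsProperMap (toConfig : InjTuple X k → Config X k) := by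
  rw [isProperMap_iff_isClosedMap_and_compact_fibers]
  refine ⟨continuous_toConfig, fun s hs => ?_, fun c => ?_⟩
  · rw [← isQuotientMap_quotient_mk'.isClosed_preimage]
    change IsClosed (toConfig ⁻¹' (toConfig '' s))
    rw [preimage_image_toConfig]
    exact isClosed_iUnion_of_finite fun τ => hs.preimage (continuous_permTuple τ)
  · obtain ⟨f, rfl⟩ := Quotient.mk_surjective c
    refine Set.Finite.isCompact ((Set.finite_range fun τ => permTuple τ f).subset fun g hg => ?_)
    obtain ⟨τ, rfl⟩ := toConfig_eq_toConfig_iff.1 hg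
    exact ⟨τ, rfl⟩

end ConfigurationSpace

section HalfPlane

open scoped NNReal

variable {k : ℕ}

/-- Translation of the half-plane away from its boundary line. -/
def shiftPsi (a : ℝ≥0) (p : Psi) : Psi :=
  ⟨(p.1.1 - a, p.1.2 + a), by
    change p.1.1 - (a : ℝ) ≤ p.1.2 + (a : ℝ)
    linarith [p.2, a.coe_nonneg]⟩

lemma shiftPsi_injective (a : ℝ≥0) : Function.Injective (shiftPsi a) := by
  intro p q h
  simpa [shiftPsi, Subtype.ext_iff, Prod.ext_iff] using h

/-- Translation of an injective tuple in the half-plane away from the boundary line. -/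
def shiftTuple (p : InjTuple Psi k × ℝ≥0) : InjTuple Psi k :=
  ⟨shiftPsi p.2 ∘ p.1.1, (shiftPsi_injective p.2).comp p.1.2⟩

lemma continuous_shiftTuple : Continuous (shiftTuple : InjTuple Psi k × ℝ≥0 → _) := by
  refine Continuous.subtype_mk (continuous_pi fun m => Continuous.subtype_mk ?_ _) _
  have h : Continuous fun p : InjTuple Psi k × ℝ≥0 => (p.1.1 m).1 :=
    continuous_subtype_val.comp ((continuous_apply m).comp
      (continuous_subtype_val.comp continuous_fst))
  have ha : Continuous fun p : InjTuple Psi k × ℝ≥0 => (p.2 : ℝ) :=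
    NNReal.continuous_coe.comp continuous_snd
  exact (h.fst.sub ha).prodMk (h.snd.add ha)

/-- The coordinates of an injective tuple, as a point of a Euclidean space. -/
def tupleCoords (f : InjTuple Psi k) : Fin k → ℝ × ℝ := fun m => (f.1 m).1

lemma isEmbedding_tupleCoords :
    Topology.IsEmbedding (tupleCoords : InjTuple Psi k → Fin k → ℝ × ℝ) :=
  (Topology.IsEmbedding.piMap fun _ => Topology.IsEmbedding.subtypeVal).comp
    Topology.IsEmbedding.subtypeVal

lemma isClosedEmbedding_shiftTuple_prodMk_snd : Topology.IsClosedEmbedding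
    fun p : InjTuple Psi k × ℝ≥0 => (shiftTuple p, p.2) := by
  refine ⟨?_, ?_⟩
  · let shear : (Fin k → ℝ × ℝ) × ℝ≥0 ≃ₜ (Fin k → ℝ × ℝ) × ℝ≥0 :=
      { toFun := fun q => (fun m => ((q.1 m).1 - q.2, (q.1 m).2 + q.2), q.2)
        invFun := fun q => (fun m => ((q.1 m).1 + q.2, (q.1 m).2 - q.2), q.2)
        left_inv := fun q => by simp
        right_inv := fun q => by simp
        continuous_toFun := by fun_prop
        continuous_invFun := by fun_prop }
    have he := isEmbedding_tupleCoords (k := k).prodMap (Topology.IsEmbedding.id (X := ℝ≥0))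
    exact Topology.IsEmbedding.of_comp (continuous_shiftTuple.prodMk continuous_snd)
      he.continuous (shear.isEmbedding.comp he)
  · have hr : Set.range (fun p : InjTuple Psi k × ℝ≥0 => (shiftTuple p, p.2)) =
        ⋂ m, {q | (tupleCoords q.1 m).1 + q.2 ≤ (tupleCoords q.1 m).2 - q.2} := by
      ext ⟨g, a⟩
      simp only [Set.mem_range, Set.mem_iInter, Set.mem_ofPred_eq, Prod.mk.injEq, Prod.exists]
      constructor
      · rintro ⟨f, b, rfl, rfl⟩ m
        simpa [tupleCoords, shiftTuple, shiftPsi] using (f.1 m).2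
      · intro h
        refine ⟨⟨fun m => ⟨((tupleCoords g m).1 + a, (tupleCoords g m).2 - a), h m⟩,
          fun m n hmn => g.2 ?_⟩, a, ?_, rfl⟩
        · simpa [Subtype.ext_iff, Prod.ext_iff, tupleCoords] using hmn
        · refine Subtype.ext (funext fun m => Subtype.ext ?_)
          simp [shiftTuple, shiftPsi, tupleCoords]
    rw [hr]
    have hc := isEmbedding_tupleCoords (k := k).continuous
    exact isClosed_iInter fun m => isClosed_le (by fun_prop) (by fun_prop)

/-- Translation of a configuration in the half-plane away from the boundary line. -/
def shiftConfig (p : Config Psi k × ℝ≥0) : Config Psi k :=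
  Quotient.map' (s₁ := configSetoid Psi k) (s₂ := configSetoid Psi k)
    (fun f => shiftTuple (f, p.2))
    (fun _ _ ⟨τ, h⟩ => ⟨τ, by simp only [shiftTuple, h, Function.comp_assoc]⟩) p.1

lemma shiftConfig_toConfig (f : InjTuple Psi k) (a : ℝ≥0) :
    shiftConfig (toConfig f, a) = toConfig (shiftTuple (f, a)) := rfl

lemma continuous_shiftConfig : Continuous (shiftConfig : Config Psi k × ℝ≥0 → _) :=
  (isOpenQuotientMap_toConfig.prodMap IsOpenQuotientMap.id).isQuotientMap.continuous_iff.2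
    (continuous_toConfig.comp continuous_shiftTuple)

lemma shiftConfig_zero (c : Config Psi k) : shiftConfig (c, 0) = c := by
  obtain ⟨f, rfl⟩ := Quotient.mk_surjective c
  exact congrArg toConfig (Subtype.ext (funext fun m => Subtype.ext (by
    simp [shiftTuple, shiftPsi])))

/-- A compact set of configurations can only be reached by translations of bounded length. -/
lemma exists_bound_of_shiftConfig_mem (hk : 1 ≤ k) {K : Set (Config Psi k)} (hK : IsCompact K) :
    ∃ M : ℝ≥0, ∀ c a, shiftConfig (c, a) ∈ K → a ≤ M := by
  have hK' : IsCompact (toConfig ⁻¹' K) := isProperMap_toConfig.isCompact_preimage hK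
  let m : Fin k := ⟨0, hk⟩
  have hc := isEmbedding_tupleCoords (k := k).continuous
  obtain ⟨M, hM⟩ := hK'.bddAbove_image
    (f := fun f => (tupleCoords f m).2 - (tupleCoords f m).1) (by fun_prop)
  refine ⟨M.toNNReal, fun c a h => ?_⟩
  obtain ⟨f, rfl⟩ := Quotient.mk_surjective c
  have h1 := hM ⟨shiftTuple (f, a), h, rfl⟩
  have h2 := (f.1 m).2
  simp only [tupleCoords, shiftTuple, shiftPsi, Function.comp_apply] at h1
  refine NNReal.le_toNNReal_of_coe_le ?_
  linarith [a.coe_nonneg]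

lemma isCompact_isClosed_setOf_shiftConfig_mem (hk : 1 ≤ k) {K : Set (Config Psi k)}
    (hK : IsCompact K) :
    IsClosed {c | ∃ a, shiftConfig (c, a) ∈ K} ∧ IsCompact {c | ∃ a, shiftConfig (c, a) ∈ K} := by
  obtain ⟨M, hM⟩ := exists_bound_of_shiftConfig_mem hk hK
  have hc := ((isClosedEmbedding_shiftTuple_prodMk_snd.isCompact_preimage
    ((isProperMap_toConfig.isCompact_preimage hK).prod (isCompact_Icc (a := 0) (b := M)))).image
      continuous_fst)
  have heq : {c | ∃ a, shiftConfig (c, a) ∈ K} = toConfig '' (Prod.fst ''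
      ((fun p : InjTuple Psi k × ℝ≥0 => (shiftTuple p, p.2)) ⁻¹'
        ((toConfig ⁻¹' K) ×ˢ Set.Icc 0 M))) := by
    ext c
    constructor
    · rintro ⟨a, h⟩
      have ha := hM c a h
      obtain ⟨f, rfl⟩ := Quotient.mk_surjective c
      exact ⟨f, ⟨(f, a), ⟨h, zero_le, ha⟩, rfl⟩, rfl⟩
    · rintro ⟨f, ⟨⟨g, a⟩, ⟨h, -⟩, rfl⟩, rfl⟩
      exact ⟨a, h⟩
  rw [heq]
  exact ⟨isProperMap_toConfig.isClosedMap _ hc.isClosed, hc.image continuous_toConfig⟩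

/-- The translation length at time `s` of the contraction. -/
noncomputable def shiftLength (s : unitInterval) : ℝ≥0 :=
  Real.toNNReal ((s : ℝ) / (1 - s))

open Classical in
/-- The contraction of the one-point compactification which translates configurations to
infinity. -/
noncomputable def shiftToInfty (p : unitInterval × OnePoint (Config Psi k)) :
    OnePoint (Config Psi k) :=
  if p.1 = 1 then OnePoint.infty else p.2.map fun c => shiftConfig (c, shiftLength p.1)

lemma continuousAt_shiftLength {s : unitInterval} (hs : s ≠ 1) : ContinuousAt shiftLength s := by
  have h : (1 : ℝ) - s ≠ 0 := sub_ne_zero.2 fun h => hs (Subtype.ext h.symm)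
  have h' : ContinuousAt (fun s : unitInterval => (s : ℝ)) s :=
    continuous_subtype_val.continuousAt
  exact continuous_real_toNNReal.continuousAt.comp (h'.div (continuousAt_const.sub h') h)

lemma eventually_lt_shiftLength (M : ℝ≥0) :
    ∀ᶠ s : unitInterval in nhds 1, s ≠ 1 → M < shiftLength s := by
  have h : ∀ᶠ s : unitInterval in nhds 1, (M : ℝ) * (1 - s) < s := by
    refine ContinuousAt.eventually_lt (f := fun s : unitInterval => (M : ℝ) * (1 - s))
      (g := fun s => (s : ℝ)) (by fun_prop) (by fun_prop) (by simp)
  filter_upwards [h] with s hs hs1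
  have hpos : (0 : ℝ) < 1 - s := sub_pos.2 (lt_of_le_of_ne s.2.2 fun h => hs1 (Subtype.ext h))
  rw [shiftLength, Real.lt_toNNReal_iff_coe_lt, lt_div_iff₀ hpos]
  exact hs

lemma continuousAt_shiftToInfty_of_eq_infty (hk : 1 ≤ k)
    {p : unitInterval × OnePoint (Config Psi k)} (hp : p.1 = 1 ∨ p.2 = OnePoint.infty) :
    ContinuousAt shiftToInfty p := by
  have hval : shiftToInfty p = OnePoint.infty := by
    rcases hp with hp | hp <;> simp [shiftToInfty, hp]
  rw [ContinuousAt, hval, OnePoint.hasBasis_nhds_infty.tendsto_right_iff]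
  rintro K ⟨-, hK⟩
  obtain ⟨hLc, hL⟩ := isCompact_isClosed_setOf_shiftConfig_mem hk hK
  obtain ⟨M, hM⟩ := exists_bound_of_shiftConfig_mem hk hK
  suffices h : ∀ᶠ q : unitInterval × OnePoint (Config Psi k) in nhds p, ∀ c : Config Psi k,
      q.2 = c → q.1 ≠ 1 → shiftConfig (c, shiftLength q.1) ∉ K by
    filter_upwards [h] with q hq
    by_cases h1 : q.1 = 1
    · exact .inr (by simp [shiftToInfty, h1])
    · induction hc : q.2 using OnePoint.rec with
      | infty => exact .inr (by simp [shiftToInfty, h1, hc])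
      | coe c => exact .inl ⟨_, hq c hc h1, by simp [shiftToInfty, h1, hc]⟩
  obtain ⟨s, y⟩ := p
  rcases hp with hp | hp
  · obtain rfl : s = 1 := hp
    filter_upwards [continuousAt_fst.eventually (eventually_lt_shiftLength M)] with q hq c hc h1 h
    exact (hq h1).not_ge (hM _ _ h)
  · obtain rfl : y = OnePoint.infty := hp
    filter_upwards [continuousAt_snd.eventually
      (OnePoint.hasBasis_nhds_infty.mem_of_mem ⟨hLc, hL⟩)] with q hq c hc h1 h
    rcases hq with ⟨d, hd, hdq⟩ | hq
    · rw [← hdq, OnePoint.coe_eq_coe] at hc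
      exact hd ⟨_, hc ▸ h⟩
    · exact OnePoint.infty_ne_coe c ((Set.mem_singleton_iff.1 hq).symm.trans hc)

lemma continuousAt_shiftToInfty_coe {s : unitInterval} (hs : s ≠ 1) (c : Config Psi k) :
    ContinuousAt shiftToInfty (s, (c : OnePoint (Config Psi k))) := by
  have hemb : Topology.IsOpenEmbedding
      (Prod.map id OnePoint.some : unitInterval × Config Psi k → _ × OnePoint (Config Psi k)) :=
    Topology.IsOpenEmbedding.id.prodMap OnePoint.isOpenEmbedding_coe
  refine (hemb.continuousAt_iff (x := (s, c))).1 ?_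
  have hcont : ContinuousAt (fun q : unitInterval × Config Psi k =>
      (shiftConfig (q.2, shiftLength q.1) : OnePoint (Config Psi k))) (s, c) :=
    (OnePoint.continuous_coe.comp continuous_shiftConfig).continuousAt.comp
      (continuousAt_snd.prodMk (ContinuousAt.comp (f := Prod.fst)
        (continuousAt_shiftLength hs) continuousAt_fst))
  refine hcont.congr ?_
  filter_upwards [continuousAt_fst.eventually (isOpen_ne.mem_nhds hs)] with q hq
  simp [shiftToInfty, show q.1 ≠ 1 from hq]

lemma continuous_shiftToInfty (hk : 1 ≤ k) :
    Continuous (shiftToInfty : unitInterval × OnePoint (Config Psi k) → _) := by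
  refine continuous_iff_continuousAt.2 fun ⟨s, y⟩ => ?_
  by_cases hs : s = 1
  · exact continuousAt_shiftToInfty_of_eq_infty hk (.inl hs)
  · induction y using OnePoint.rec with
    | infty => exact continuousAt_shiftToInfty_of_eq_infty hk (.inr rfl)
    | coe c => exact continuousAt_shiftToInfty_coe hs c

lemma contractibleSpace_onePoint_config (hk : 1 ≤ k) :
    ContractibleSpace (OnePoint (Config Psi k)) := by
  refine (contractible_iff_id_nullhomotopic _).2 ⟨OnePoint.infty, ⟨⟨⟨shiftToInfty,
    continuous_shiftToInfty hk⟩, fun y => ?_, fun y => ?_⟩⟩⟩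
  · induction y using OnePoint.rec <;> simp [shiftToInfty, shiftLength, shiftConfig_zero]
  · simp [shiftToInfty]

end HalfPlane

/-- For every integer `k ≥ 1` and every degree `i`, the
reduced singular homology with `ℤ` coefficients of the one-point
compactification of the unordered configuration space `B(Ψ, k)` of the closed
half-plane `Ψ` vanishes. -/
theorem reduced_homology_config_halfplane_vanishes (k : ℕ) (hk : 1 ≤ k) (i : ℕ) :
    Subsingleton (RedHomology (OnePoint (Config Psi k)) i) := by
  have := contractibleSpace_onePoint_config hk
  exact subsingleton_redHomology_of_contractible _ i
end
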